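/- arXiv:math/0102149 — 10 statements merged into one kernel-verified Lean document; each statement's English description precedes it below -/
import Mathlib

section
/- Suppose that for each l coprime to n there exists a diagonal matrix Z_l with Z_l^N = 1 such that σ_l(Λ(1/N)) = Λ(l/N)·G_l·Z_l and σ_l(Λ(l/N)) = Z_l^l·G_l^{−1}·Λ(1/N). Then G_l^{−1}·T·G_l = T^{l²} for every integer l coprime to n. -/
open Matrix Complex

abbrev SL2Z := Matrix.SpecialLinearGroup (Fin 2) ℤ

def sM : SL2Z := ⟨!![0, -1; 1, 0], by norm_num [Matrix.det_fin_two_of]⟩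
def tM : SL2Z := ⟨!![1, 1; 0, 1], by norm_num [Matrix.det_fin_two_of]⟩

theorem exists_ringHom_extending {k K : Type*} [Field k] [Field K] [Algebra k K] [IsAlgClosed K]
    (σ : k ≃+* k) : ∃ f : K →+* K, ∀ x : k, f (algebraMap k K x) = algebraMap k K (σ x) := by
  obtain ⟨s, hs⟩ := exists_isTranscendenceBasis k K
  let := IsAlgClosed.isAlgClosure_of_transcendence_basis _ hs
  let e := hs.1.aevalEquiv
  let g := (e.symm.toRingEquiv.trans (MvPolynomial.mapEquiv s σ)).trans e.toRingEquiv
  refine ⟨(IsAlgClosure.equivOfEquiv K K g).toRingHom, fun x => ?_⟩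
  have h := IsAlgClosure.equivOfEquiv_algebraMap K K g (algebraMap _ _ x)
  have hg : g (algebraMap _ _ x) = algebraMap _ _ (σ x) := by
    simpa [g, MvPolynomial.algebraMap_eq] using e.commutes (σ x)
  rw [hg] at h
  exact h

theorem exists_ringHom_zpow {n : ℕ} (hn : 0 < n) {ζ : ℂ} (hζ : IsPrimitiveRoot ζ n) {l : ℤ}
    (hl : IsCoprime l (n : ℤ)) : ∃ f : ℂ →+* ℂ, f ζ = ζ ^ l := by
  let z : algebraicClosure ℚ ℂ :=
    ⟨ζ, mem_algebraicClosure_iff.mpr (hζ.isIntegral hn).tower_top.isAlgebraic⟩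
  have hz : IsPrimitiveRoot z n :=
    IsPrimitiveRoot.of_map_of_injective (f := algebraMap (algebraicClosure ℚ ℂ) ℂ) hζ
      (algebraMap (algebraicClosure ℚ ℂ) ℂ).injective
  have hconj : IsConjRoot ℚ (z ^ l) z := by
    rw [IsConjRoot, ← Polynomial.cyclotomic_eq_minpoly_rat hz hn,
      ← Polynomial.cyclotomic_eq_minpoly_rat
        (hz.zpow_of_gcd_eq_one l (Int.isCoprime_iff_gcd_eq_one.mp hl)) hn]
  have : IsAlgClosure ℚ (algebraicClosure ℚ ℂ) := algebraicClosure.isAlgClosure ℚ ℂ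
  have : Normal ℚ (algebraicClosure ℚ ℂ) := IsAlgClosure.normal ℚ _
  obtain ⟨τ, hτ⟩ := isConjRoot_iff_exists_algEquiv.mp hconj
  obtain ⟨f, hf⟩ := exists_ringHom_extending (K := ℂ) τ.toRingEquiv
  refine ⟨f, ?_⟩
  have h : f ζ = algebraMap _ ℂ (τ z) := hf z
  rw [h, hτ, map_zpow₀]
  rfl

theorem IsPrimitiveRoot.map_eq_zpow {K : Type*} [Field K] {n : ℕ} (hn : 0 < n) {ζ : K}
    (hζ : IsPrimitiveRoot ζ n) {f : K →+* K} {l : ℤ} (hf : f ζ = ζ ^ l) {x : K}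
    (hx : x ^ n = 1) : f x = x ^ l := by
  have : NeZero n := ⟨hn.ne'⟩
  obtain ⟨i, -, rfl⟩ := hζ.eq_pow_of_pow_eq_one hx
  rw [map_pow, hf, ← zpow_natCast, ← zpow_natCast, zpow_comm]

theorem tM_pow (k : ℕ) : ((tM ^ k : SL2Z) : Matrix (Fin 2) (Fin 2) ℤ) = !![1, (k : ℤ); 0, 1] := by
  have h : tM = ModularGroup.T := rfl
  rw [h, ← zpow_natCast, ModularGroup.coe_T_zpow]

/-- A homomorphism from `SL(2, ℤ)` killing `t ^ N` also kills the conjugate of `t ^ (-N)` by `s`. -/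
theorem map_lower_eq_one {H : Type*} [Group H] (ρ : SL2Z →* H) {N : ℕ} (hN : ρ tM ^ N = 1)
    (m : SL2Z) (hm : (m : Matrix (Fin 2) (Fin 2) ℤ) = !![1, 0; (N : ℤ), 1]) : ρ m = 1 := by
  have h : m * sM * tM ^ N = sM := by
    apply Subtype.ext
    rw [Matrix.SpecialLinearGroup.coe_mul, Matrix.SpecialLinearGroup.coe_mul, tM_pow, hm]
    simp [sM]
  have h' := congrArg ρ h
  rw [map_mul, map_mul, map_pow, hN, mul_one] at h'
  exact mul_eq_right.mp h'

theorem Matrix.diagonal_zpow {I K : Type*} [Fintype I] [DecidableEq I] [Field K] {d : I → K}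
    (hd : ∀ i, d i ≠ 0) (k : ℤ) : diagonal d ^ k = diagonal fun i => d i ^ k := by
  have hpow (j : ℕ) : diagonal d ^ (j : ℤ) = diagonal fun i => d i ^ (j : ℤ) := by
    rw [zpow_natCast, diagonal_pow]
    simp only [zpow_natCast]
    rfl
  obtain ⟨j, rfl | rfl⟩ := k.eq_nat_or_neg
  · exact hpow j
  · rw [Matrix.zpow_neg_natCast, ← zpow_natCast, hpow]
    refine inv_eq_left_inv ?_
    rw [diagonal_mul_diagonal, ← diagonal_one]
    congr 1
    ext i
    rw [← zpow_add₀ (hd i), neg_add_cancel, zpow_zero]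

section SignedPerm

variable {I : Type*} [Fintype I] [DecidableEq I] {G : Matrix I I ℂ} {π : Equiv.Perm I} {ε : I → ℂ}

theorem signedPerm_transpose_mul_diagonal_mul (hε : ∀ p, ε p = 1 ∨ ε p = -1)
    (hG : ∀ p q, G p q = ε q * (if p = π q then 1 else 0)) (f : I → ℂ) :
    Gᵀ * diagonal f * G = diagonal (f ∘ π) := by
  ext p q
  rw [mul_apply]
  simp only [mul_diagonal, transpose_apply, hG, diagonal_apply, Function.comp]
  by_cases h : p = q
  · subst h
    rcases hε p with h | h <;> simp [h]
  · simp [h, Ne.symm h]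

theorem signedPerm_inv (hε : ∀ p, ε p = 1 ∨ ε p = -1)
    (hG : ∀ p q, G p q = ε q * (if p = π q then 1 else 0)) : G⁻¹ = Gᵀ := by
  refine inv_eq_left_inv ?_
  simpa [Function.comp_def] using signedPerm_transpose_mul_diagonal_mul hε hG fun _ => 1

theorem signedPerm_inv_mul_diagonal_mul (hε : ∀ p, ε p = 1 ∨ ε p = -1)
    (hG : ∀ p q, G p q = ε q * (if p = π q then 1 else 0)) (f : I → ℂ) :
    G⁻¹ * diagonal f * G = diagonal (f ∘ π) := by
  rw [signedPerm_inv hε hG, signedPerm_transpose_mul_diagonal_mul hε hG]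

end SignedPerm

theorem signedPerm_map {I : Type*} [DecidableEq I] {G : Matrix I I ℂ} {π : Equiv.Perm I}
    {ε : I → ℂ} (hε : ∀ p, ε p = 1 ∨ ε p = -1)
    (hG : ∀ p q, G p q = ε q * (if p = π q then 1 else 0)) (σ : ℂ →+* ℂ) : G.map σ = G := by
  ext p q
  rcases hε q with h | h <;> by_cases hp : p = π q <;> simp [hG, h, hp]

/-- If `u ^ 2 = d ^ (2 * l ^ 2) * z ^ (2 * l)` where `z` is an `N`-th root of unity and `u`, `d` are
`N ^ 2`-th roots of unity, then `u ^ N = d ^ (N * l ^ 2)`. -/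
theorem pow_eq_of_sq_eq {K : Type*} [Field K] {u d z : K} (hd0 : d ≠ 0) {N : ℕ}
    (hz : z ^ N = 1) (hu : (u ^ N) ^ N = 1) (hd : (d ^ N) ^ N = 1) {l : ℤ}
    (h : u ^ 2 = d ^ (2 * l ^ 2) * z ^ (2 * l)) : u ^ N = (d ^ N) ^ (l ^ 2) := by
  have hpow (k : ℕ) : u ^ (2 * k) = d ^ (2 * k * l ^ 2) * z ^ (2 * k * l) := by
    rw [pow_mul, h, mul_pow, ← _root_.zpow_natCast (d ^ _), ← _root_.zpow_natCast (z ^ _),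
      ← _root_.zpow_mul, ← _root_.zpow_mul]
    congr 2 <;> ring
  have hcast {x : K} (m : ℕ) (k : ℤ) : x ^ ((m : ℤ) * k) = (x ^ m) ^ k := by
    rw [_root_.zpow_mul, _root_.zpow_natCast]
  rcases Nat.even_or_odd' N with ⟨M, hM | hM⟩
  · have h' := hpow M
    rw [show (2 * M : ℤ) = (N : ℤ) by rw [hM]; push_cast; ring, ← hM, hcast, hcast, hz,
      _root_.one_zpow, mul_one] at h'
    exact h'
  · have h' := hpow (N * (M + 1))
    rw [show 2 * (N * (M + 1)) = N * N + N by rw [hM]; ring, pow_add, pow_mul, hu, one_mul,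
      show 2 * ((N * (M + 1) : ℕ) : ℤ) * l ^ 2 = ((N * N : ℕ) : ℤ) * l ^ 2 + (N : ℤ) * l ^ 2 by
        rw [hM]; push_cast; ring,
      show 2 * ((N * (M + 1) : ℕ) : ℤ) * l = (N : ℤ) * (2 * (M + 1) * l) by push_cast; ring,
      zpow_add₀ hd0, hcast, hcast, hcast, pow_mul, hd, hz, _root_.one_zpow, _root_.one_zpow, one_mul,
      mul_one] at h'
    exact h'

theorem stmt0
    {I : Type} [Fintype I] [DecidableEq I] [Nonempty I] (i0 : I)
    (ρ : SL2Z →* (Matrix I I ℂ)ˣ)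
    (S T : Matrix I I ℂ)
    (hSdef : S = (↑(ρ sM) : Matrix I I ℂ)) (hTdef : T = (↑(ρ tM) : Matrix I I ℂ))
    (n N : ℕ) (hn : 0 < n) (hNpos : 0 < N) (hNdvd : N ∣ n)
    (hTdiag : T.IsDiag) (hTord : orderOf T = N)
    (hSsymm : S.IsSymm) (hSunit : Sᴴ * S = 1)
    (ζ : ℂ) (hζ : ζ = Complex.exp (2 * Real.pi * Complex.I / n))
    (hSfield : ∀ p q, S p q ∈ IntermediateField.adjoin ℚ {ζ})
    (perm : ℤ → Equiv.Perm I) (ε : ℤ → I → ℂ) (G : ℤ → Matrix I I ℂ)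
    (hε : ∀ l : ℤ, IsCoprime l (n : ℤ) → ∀ p, ε l p = 1 ∨ ε l p = -1)
    (hG : ∀ (l : ℤ) (p q : I), G l p q = ε l q * (if p = perm l q then 1 else 0))
    (hGal : ∀ l : ℤ, IsCoprime l (n : ℤ) → ∀ σ : ℂ →+* ℂ, σ ζ = ζ ^ l →
      S.map σ = S * G l ∧ G l * S.map σ = S)
    (X : Matrix I I ℂ) (hXdiag : X.IsDiag) (hXpow : X ^ (N : ℕ) = T)
    (hXroot : ∀ p, X p p ^ n = 1)
    (Λ : ℤ → Matrix I I ℂ)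
    (hΛ : ∀ (k x y : ℤ) (h : k * x - y * (N : ℤ) = 1),
      Λ k = X ^ (-k) *
        (↑(ρ ⟨!![k, y; (N : ℤ), x], by rw [Matrix.det_fin_two_of]; linarith⟩) : Matrix I I ℂ) *
        X ^ (-x))
    (hZ : ∀ l : ℤ, IsCoprime l (n : ℤ) → ∃ Z : Matrix I I ℂ, Z.IsDiag ∧ Z ^ (N : ℕ) = 1 ∧
      ∀ σ : ℂ →+* ℂ, σ ζ = ζ ^ l →
        (Λ 1).map σ = Λ l * G l * Z ∧ (Λ l).map σ = Z ^ l * (G l)⁻¹ * Λ 1) :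
    ∀ l : ℤ, IsCoprime l (n : ℤ) → (G l)⁻¹ * T * G l = T ^ (l ^ 2 : ℤ) := by
  intro l hl
  have hprim : IsPrimitiveRoot ζ n := hζ ▸ Complex.isPrimitiveRoot_exp n hn.ne'
  obtain ⟨σ, hσ⟩ := exists_ringHom_zpow hn hprim hl
  have hσroot {x : ℂ} (hx : x ^ n = 1) : σ x = x ^ l := hprim.map_eq_zpow hn hσ hx
  obtain ⟨Z, hZdiag, hZpow, hZσ⟩ := hZ l hl
  obtain ⟨h₁, h₂⟩ := hZσ σ hσ
  obtain ⟨d, rfl⟩ : ∃ d, X = diagonal d := ⟨_, hXdiag.diagonal_diag.symm⟩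
  obtain ⟨z, rfl⟩ : ∃ z, Z = diagonal z := ⟨_, hZdiag.diagonal_diag.symm⟩
  simp only [diagonal_apply_eq] at hXroot
  have hd0 (i : I) : d i ≠ 0 := fun h => by simpa [h, hn.ne'] using hXroot i
  have hzN (i : I) : z i ^ N = 1 := by
    simpa [diagonal_pow] using congrFun (congrFun hZpow i) i
  have hzn (i : I) : z i ^ n = 1 := by
    obtain ⟨c, rfl⟩ := hNdvd
    rw [pow_mul, hzN, one_pow]
  have hz0 (i : I) : z i ≠ 0 := fun h => by simpa [h, hn.ne'] using hzn i
  have hT : T ^ N = 1 := hTord ▸ pow_orderOf_eq_one T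
  have hTd : T = diagonal (d ^ N) := by rw [← hXpow, diagonal_pow]
  have hdN (i : I) : (d i ^ N) ^ N = 1 := by
    rw [hTd, diagonal_pow] at hT
    simpa using congrFun (congrFun hT i) i
  have hρ : ρ tM ^ N = 1 := by
    apply Units.ext
    rw [Units.val_pow_eq_pow_val, ← hTdef, hT, Units.val_one]
  have hΛ1 : Λ 1 = diagonal fun i => d i ^ (-2 : ℤ) := by
    have hm := congrArg Units.val (map_lower_eq_one ρ hρ
      ⟨!![1, 0; (N : ℤ), 1], by simp [Matrix.det_fin_two_of]⟩ rfl)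
    rw [(hΛ 1 1 0 (by ring)).trans
      (congrArg (fun M => diagonal d ^ (-1 : ℤ) * M * diagonal d ^ (-1 : ℤ)) hm),
      Units.val_one, mul_one, Matrix.diagonal_zpow hd0, diagonal_mul_diagonal]
    congr 1
    ext i
    rw [← zpow_add₀ (hd0 i)]
    rfl
  have hσd (i : I) : σ (d i) = d i ^ l := hσroot (hXroot i)
  have hσz (i : I) : σ (z i) = z i ^ l := hσroot (hzn i)
  have h₃ : ((Λ 1).map σ).map σ = (Λ l).map σ * G l * (diagonal z).map σ := by
    rw [h₁, Matrix.map_mul, Matrix.map_mul, signedPerm_map (hε l hl) (hG l)]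
  rw [h₂, hΛ1, Matrix.mul_assoc (diagonal z ^ l), Matrix.mul_assoc (diagonal z ^ l),
    signedPerm_inv_mul_diagonal_mul (hε l hl) (hG l), Matrix.diagonal_zpow hz0] at h₃
  simp only [diagonal_map (map_zero σ), diagonal_mul_diagonal, map_zpow₀, hσd, hσz,
    Function.comp_def] at h₃
  rw [hTd, signedPerm_inv_mul_diagonal_mul (hε l hl) (hG l),
    Matrix.diagonal_zpow (d := d ^ N) fun i => pow_ne_zero N (hd0 i)]
  congr 1
  ext i
  refine pow_eq_of_sq_eq (hd0 i) (hzN i) (hdN _) (hdN i) ?_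
  have h := congrFun (diagonal_injective h₃) i
  have hu0 := hd0 (perm l i)
  have hx0 := zpow_ne_zero (l ^ 2) (hd0 i)
  have hy0 := zpow_ne_zero l (hz0 i)
  rw [← _root_.zpow_mul (d i) l l, ← sq, _root_.zpow_neg, _root_.zpow_neg] at h
  simp only [zpow_ofNat] at h
  rw [_root_.zpow_mul', _root_.zpow_mul', zpow_ofNat, zpow_ofNat]
  field_simp at h
  exact h
end

section
/- For every m ∈ SL(2,ℤ), every entry of ρ(m) lies in ℚ(ζ_n), and for every integer l coprime to n one has G_l^{−1}·ρ(m)·G_l = σ_l(σ_l(ρ(m))). -/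
open Matrix Complex

theorem closure_sM_tM : Subgroup.closure {sM, tM} = (⊤ : Subgroup SL2Z) := by
  have hs : sM = ModularGroup.S := rfl
  have ht : tM = ModularGroup.T := rfl
  rw [hs, ht]
  exact SpecialLinearGroup.SL2Z_generators

/-- The invertible matrices whose entries, together with those of the inverse,
lie in a given subfield. -/
def entriesSubgroup {I L : Type*} [Fintype I] [DecidableEq I] [Field L] (K : Subfield L) :
    Subgroup (Matrix I I L)ˣ :=
  (Units.map (K.subtype.mapMatrix (m := I) : Matrix I I K →* Matrix I I L)).range

theorem entriesSubgroup_apply_mem {I L : Type*} [Fintype I] [DecidableEq I] [Field L]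
    {K : Subfield L} {u : (Matrix I I L)ˣ} (hu : u ∈ entriesSubgroup K) (p q : I) :
    (u : Matrix I I L) p q ∈ K := by
  obtain ⟨v, rfl⟩ := hu
  exact ((v : Matrix I I K) p q).2

theorem mem_entriesSubgroup {I L : Type*} [Fintype I] [DecidableEq I] [Field L]
    {K : Subfield L} {u : (Matrix I I L)ˣ} (hu : ∀ p q, (u : Matrix I I L) p q ∈ K) :
    u ∈ entriesSubgroup K := by
  let A : Matrix I I K := Matrix.of fun p q => ⟨(u : Matrix I I L) p q, hu p q⟩
  have hA : K.subtype.mapMatrix A = (u : Matrix I I L) := rfl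
  have hdet : A.det ≠ 0 := by
    intro h
    have h1 : (u : Matrix I I L).det = 0 := by
      rw [← hA, ← RingHom.map_det, h, map_zero]
    exact ((Matrix.isUnit_iff_isUnit_det _).mp u.isUnit).ne_zero h1
  have hunit : IsUnit A := (Matrix.isUnit_iff_isUnit_det A).mpr hdet.isUnit
  exact ⟨hunit.unit, Units.ext hA⟩

/-- A ring endomorphism raising a primitive root of unity to the power `l` does the same to
every root of unity of the same order. -/
theorem map_eq_zpow_of_pow_eq_one {L : Type*} [Field L] {n : ℕ} [NeZero n] {ζ z : L}
    (hζ : IsPrimitiveRoot ζ n) (σ : L →+* L) {l : ℤ} (hσ : σ ζ = ζ ^ l) (hz : z ^ n = 1) :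
    σ z = z ^ l := by
  obtain ⟨k, -, rfl⟩ := hζ.eq_pow_of_pow_eq_one hz
  rw [map_pow, hσ, ← zpow_natCast, ← zpow_natCast, zpow_comm]

theorem stmt1
    {I : Type} [Fintype I] [DecidableEq I] [Nonempty I] (i0 : I)
    (ρ : SL2Z →* (Matrix I I ℂ)ˣ)
    (S T : Matrix I I ℂ)
    (hSdef : S = (↑(ρ sM) : Matrix I I ℂ)) (hTdef : T = (↑(ρ tM) : Matrix I I ℂ))
    (n N : ℕ) (hn : 0 < n) (hNpos : 0 < N) (hNdvd : N ∣ n)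
    (hTdiag : T.IsDiag) (hTord : orderOf T = N)
    (hSsymm : S.IsSymm) (hSunit : Sᴴ * S = 1)
    (ζ : ℂ) (hζ : ζ = Complex.exp (2 * Real.pi * Complex.I / n))
    (hSfield : ∀ p q, S p q ∈ IntermediateField.adjoin ℚ {ζ})
    (perm : ℤ → Equiv.Perm I) (ε : ℤ → I → ℂ) (G : ℤ → Matrix I I ℂ)
    (hε : ∀ l : ℤ, IsCoprime l (n : ℤ) → ∀ p, ε l p = 1 ∨ ε l p = -1)
    (hG : ∀ (l : ℤ) (p q : I), G l p q = ε l q * (if p = perm l q then 1 else 0))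
    (hGal : ∀ l : ℤ, IsCoprime l (n : ℤ) → ∀ σ : ℂ →+* ℂ, σ ζ = ζ ^ l →
      S.map σ = S * G l ∧ G l * S.map σ = S)
    (hGT : ∀ l : ℤ, IsCoprime l (n : ℤ) → (G l)⁻¹ * T * G l = T ^ (l ^ 2 : ℤ))
    :
    ∀ m : SL2Z, (∀ p q, (↑(ρ m) : Matrix I I ℂ) p q ∈ IntermediateField.adjoin ℚ {ζ}) ∧
      (∀ l : ℤ, IsCoprime l (n : ℤ) → ∀ σ : ℂ →+* ℂ, σ ζ = ζ ^ l →
        (G l)⁻¹ * (↑(ρ m) : Matrix I I ℂ) * G l = ((↑(ρ m) : Matrix I I ℂ).map σ).map σ) := by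
  have : NeZero n := ⟨hn.ne'⟩
  have hprim : IsPrimitiveRoot ζ n := hζ ▸ Complex.isPrimitiveRoot_exp n hn.ne'
  have hTd : T = Matrix.diagonal T.diag := hTdiag.diagonal_diag.symm
  have hTn : T ^ n = 1 := orderOf_dvd_iff_pow_eq_one.mp (hTord ▸ hNdvd)
  have hroot : ∀ p, T p p ^ n = 1 := by
    intro p
    have h := congrFun (congrFun hTn p) p
    rw [hTd, Matrix.diagonal_pow] at h
    simpa using h
  intro m
  have hm : m ∈ Subgroup.closure {sM, tM} := closure_sM_tM ▸ Subgroup.mem_top m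
  constructor
  · let K := (IntermediateField.adjoin ℚ {ζ}).toSubfield
    have hζK : ζ ∈ K := IntermediateField.mem_adjoin_simple_self ℚ ζ
    have hle : Subgroup.closure {sM, tM} ≤ (entriesSubgroup (I := I) K).comap ρ := by
      rw [Subgroup.closure_le]
      rintro x (rfl | rfl)
      · exact mem_entriesSubgroup fun p q => hSdef ▸ hSfield p q
      · refine mem_entriesSubgroup fun p q => ?_
        rw [← hTdef]
        by_cases hpq : p = q
        · subst hpq
          obtain ⟨k, -, hk⟩ := hprim.eq_pow_of_pow_eq_one (hroot p)
          exact hk ▸ pow_mem hζK k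
        · exact hTdiag hpq ▸ zero_mem K
    exact entriesSubgroup_apply_mem (hle hm)
  · intro l hl σ hσ
    obtain ⟨hS₁, hS₂⟩ := hGal l hl σ hσ
    have hdetG : IsUnit (G l).det := by
      have hSdet : IsUnit S.det :=
        (Matrix.isUnit_iff_isUnit_det S).mp (hSdef ▸ (ρ sM).isUnit)
      rw [← hS₂, Matrix.det_mul] at hSdet
      exact isUnit_of_mul_isUnit_left hSdet
    have hGσ : (G l).map σ = G l := by
      ext p q
      rw [Matrix.map_apply, hG]
      rcases hε l hl q with h | h <;> rw [h] <;> split_ifs <;> simp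
    let u : (Matrix I I ℂ)ˣ := Matrix.nonsingInvUnit (G l) hdetG
    let F : (Matrix I I ℂ)ˣ →* (Matrix I I ℂ)ˣ :=
      Units.map (σ.mapMatrix : Matrix I I ℂ →+* Matrix I I ℂ).toMonoidHom
    have hSS : (G l)⁻¹ * S * G l = (S.map σ).map σ := by
      have h : S.map σ = (G l)⁻¹ * S := by
        rw [← hS₂, Matrix.nonsing_inv_mul_cancel_left _ _ hdetG, hS₂]
      rw [hS₁, Matrix.map_mul, hGσ, h]
    have hTT : (G l)⁻¹ * T * G l = (T.map σ).map σ := by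
      have hdiag : ∀ k : ℕ, T ^ k = Matrix.diagonal (T.diag ^ k) := by
        intro k
        conv_lhs => rw [hTd]
        rw [Matrix.diagonal_pow]
      have hnat : l ^ 2 = ((l.natAbs ^ 2 : ℕ) : ℤ) := by simp
      rw [hGT l hl, hnat, zpow_natCast, hdiag]
      ext p q
      rw [Matrix.map_apply, Matrix.map_apply]
      by_cases hpq : p = q
      · subst hpq
        rw [Matrix.diagonal_apply_eq, map_eq_zpow_of_pow_eq_one hprim σ hσ (hroot p),
          map_zpow₀, map_eq_zpow_of_pow_eq_one hprim σ hσ (hroot p), ← _root_.zpow_mul, ← sq, hnat,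
          zpow_natCast]
        rfl
      · rw [Matrix.diagonal_apply_ne _ hpq, hTdiag hpq, map_zero, map_zero]
    have heq : Set.EqOn ((MulAut.conj u⁻¹).toMonoidHom.comp ρ) ((F.comp F).comp ρ)
        (Subgroup.closure {sM, tM}) := by
      apply MonoidHom.eqOn_closure
      rintro x (rfl | rfl)
      · rw [hSdef] at hSS; exact Units.ext hSS
      · rw [hTdef] at hTT; exact Units.ext hTT
    exact congrArg Units.val (heq hm)
end

section
/- For every integer l coprime to n and every integer l̂ with l·l̂ ≡ 1 (mod N), one has G_l = S^{−1}·T^l·S·T^{l̂}·S·T^l. -/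
open Matrix Complex

/-- An automorphism of a subfield extends to any algebraically closed overfield. -/
theorem exists_ringEquiv_extending {F K : Type*} [Field F] [Field K] [Algebra F K]
    [IsAlgClosed K] (φ : F ≃+* F) :
    ∃ σ : K ≃+* K, ∀ x : F, σ (algebraMap F K x) = algebraMap F K (φ x) := by
  obtain ⟨s, hs⟩ := exists_isTranscendenceBasis F K
  have := IsAlgClosed.isAlgClosure_of_transcendence_basis _ hs
  let a := hs.1.aevalEquiv
  let e := a.symm.toRingEquiv.trans ((MvPolynomial.mapEquiv s φ).trans a.toRingEquiv)
  refine ⟨IsAlgClosure.equivOfEquiv K K e, fun x => ?_⟩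
  rw [IsScalarTower.algebraMap_apply F (Algebra.adjoin F (Set.range ((↑) : s → K))) K,
    IsAlgClosure.equivOfEquiv_algebraMap]
  have he : e (algebraMap F _ x) = algebraMap F _ (φ x) := by
    change a (MvPolynomial.map (φ : F →+* F) (a.symm (algebraMap F _ x))) = _
    rw [a.symm.commutes, MvPolynomial.algebraMap_eq, MvPolynomial.map_C,
      ← MvPolynomial.algebraMap_eq, a.commutes]
    rfl
  rw [he, ← IsScalarTower.algebraMap_apply]

/-- Every Galois conjugation of roots of unity is induced by a field automorphism of `ℂ`. -/
theorem IsPrimitiveRoot.exists_ringEquiv_complex {n : ℕ} [NeZero n] {ζ : ℂ}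
    (hζ : IsPrimitiveRoot ζ n) {m : ℕ} (hm : m.Coprime n) :
    ∃ σ : ℂ ≃+* ℂ, σ ζ = ζ ^ m := by
  have := NeZero.charZero (M := ℚ) (n := n)
  obtain ⟨F, _, _, _⟩ : ∃ (F : Type) (_ : Field F) (_ : Algebra ℚ F),
      IsCyclotomicExtension {n} ℚ F :=
    ⟨CyclotomicField n ℚ, _, _, CyclotomicField.isCyclotomicExtension n ℚ⟩
  have hirr := Polynomial.cyclotomic.irreducible_rat (NeZero.pos n)
  have hz := IsCyclotomicExtension.zeta_spec n ℚ F
  obtain ⟨f, hf⟩ := (hz.embeddingsEquivPrimitiveRoots ℂ hirr).surjective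
    ⟨ζ, (mem_primitiveRoots (NeZero.pos n)).2 hζ⟩
  replace hf : f (IsCyclotomicExtension.zeta n ℚ F) = ζ := by
    rw [← hz.embeddingsEquivPrimitiveRoots_apply_coe ℂ hirr, hf]
  let := f.toRingHom.toAlgebra
  let φ := IsCyclotomicExtension.fromZetaAut (hz.pow_of_coprime m hm) hirr
  obtain ⟨σ, hσ⟩ := exists_ringEquiv_extending (K := ℂ) φ.toRingEquiv
  refine ⟨σ, ?_⟩
  have h := hσ (IsCyclotomicExtension.zeta n ℚ F)
  change σ (f _) = f (φ _) at h
  rwa [IsCyclotomicExtension.fromZetaAut_spec, map_pow, hf] at h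

/-- Integer powers of a matrix of finite order depend only on the exponent modulo the order. -/
theorem Matrix.zpow_eq_zpow_of_modEq {I R : Type*} [Fintype I] [DecidableEq I] [CommRing R]
    {A : Matrix I I R} (hA : IsUnit A.det) {N : ℕ} (hN : A ^ N = 1) {a b : ℤ}
    (h : a ≡ b [ZMOD N]) : A ^ a = A ^ b := by
  obtain ⟨k, hk⟩ := h.dvd
  obtain rfl : b = a + N * k := by omega
  rw [Matrix.zpow_add hA, Matrix.zpow_mul _ hA, zpow_natCast, hN, Matrix.one_zpow, mul_one]

/-- A ring endomorphism raising a primitive `n`-th root of unity to its `m`-th power raises a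
diagonal matrix of order dividing `n` to its `m`-th power. -/
theorem Matrix.IsDiag.map_eq_pow {I R : Type*} [Fintype I] [DecidableEq I] [CommRing R]
    [IsDomain R] {A : Matrix I I R} (hA : A.IsDiag) {n m : ℕ} [NeZero n] (hn : A ^ n = 1)
    {ζ : R} (hζ : IsPrimitiveRoot ζ n) (σ : R →+* R) (hσ : σ ζ = ζ ^ m) :
    A.map σ = A ^ m := by
  obtain ⟨d, rfl⟩ : ∃ d, A = Matrix.diagonal d := ⟨_, hA.diagonal_diag.symm⟩
  rw [Matrix.diagonal_pow, ← Matrix.diagonal_one, Matrix.diagonal_eq_diagonal_iff] at hn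
  rw [Matrix.diagonal_pow, Matrix.diagonal_map (map_zero σ), Matrix.diagonal_eq_diagonal_iff]
  intro i
  obtain ⟨k, -, hk⟩ := hζ.eq_pow_of_pow_eq_one (hn i)
  simp only [Pi.pow_apply]
  rw [← hk, map_pow, hσ, pow_right_comm]

theorem tM_mul_sM_relation : tM * sM * tM * sM * tM = sM := by
  ext i j
  fin_cases i <;> fin_cases j <;> rfl

theorem stmt2
    {I : Type} [Fintype I] [DecidableEq I] [Nonempty I] (i0 : I)
    (ρ : SL2Z →* (Matrix I I ℂ)ˣ)
    (S T : Matrix I I ℂ)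
    (hSdef : S = (↑(ρ sM) : Matrix I I ℂ)) (hTdef : T = (↑(ρ tM) : Matrix I I ℂ))
    (n N : ℕ) (hn : 0 < n) (hNpos : 0 < N) (hNdvd : N ∣ n)
    (hTdiag : T.IsDiag) (hTord : orderOf T = N)
    (hSsymm : S.IsSymm) (hSunit : Sᴴ * S = 1)
    (ζ : ℂ) (hζ : ζ = Complex.exp (2 * Real.pi * Complex.I / n))
    (hSfield : ∀ p q, S p q ∈ IntermediateField.adjoin ℚ {ζ})
    (perm : ℤ → Equiv.Perm I) (ε : ℤ → I → ℂ) (G : ℤ → Matrix I I ℂ)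
    (hε : ∀ l : ℤ, IsCoprime l (n : ℤ) → ∀ p, ε l p = 1 ∨ ε l p = -1)
    (hG : ∀ (l : ℤ) (p q : I), G l p q = ε l q * (if p = perm l q then 1 else 0))
    (hGal : ∀ l : ℤ, IsCoprime l (n : ℤ) → ∀ σ : ℂ →+* ℂ, σ ζ = ζ ^ l →
      S.map σ = S * G l ∧ G l * S.map σ = S)
    (hGT : ∀ l : ℤ, IsCoprime l (n : ℤ) → (G l)⁻¹ * T * G l = T ^ (l ^ 2 : ℤ))
    :
    ∀ l lhat : ℤ, IsCoprime l (n : ℤ) → l * lhat ≡ 1 [ZMOD (N : ℤ)] →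
      G l = S⁻¹ * T ^ l * S * T ^ lhat * S * T ^ l := by
  intro l lhat hl hlhat
  have : NeZero n := ⟨hn.ne'⟩
  have hprim : IsPrimitiveRoot ζ n := hζ ▸ Complex.isPrimitiveRoot_exp n hn.ne'
  have hTu : IsUnit T.det := (Matrix.isUnit_iff_isUnit_det T).1 (hTdef ▸ (ρ tM).isUnit)
  have hSu : IsUnit S.det := (Matrix.isUnit_iff_isUnit_det S).1 (hSdef ▸ (ρ sM).isUnit)
  have hTN : T ^ N = 1 := hTord ▸ pow_orderOf_eq_one T
  have hTn : T ^ n = 1 := by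
    obtain ⟨k, rfl⟩ := hNdvd
    rw [pow_mul, hTN, one_pow]
  have hrel : T * S * T * S * T = S := by
    have h := congrArg (fun x => (↑(ρ x) : Matrix I I ℂ)) tM_mul_sM_relation
    simpa only [map_mul, Units.val_mul, ← hSdef, ← hTdef] using h
  obtain ⟨m, hm⟩ : ∃ m : ℕ, (m : ℤ) = l % n :=
    ⟨(l % n).toNat, Int.toNat_of_nonneg (Int.emod_nonneg _ (by exact_mod_cast hn.ne'))⟩
  have hml : (m : ℤ) ≡ l [ZMOD n] := hm ▸ Int.mod_modEq l n
  have hmn : m.Coprime n := by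
    rw [← Nat.isCoprime_iff_coprime, hm, Int.emod_def, sub_eq_add_neg, ← mul_neg]
    exact hl.add_mul_left_left _
  obtain ⟨σ, hσ⟩ := hprim.exists_ringEquiv_complex hmn
  have hζl : ζ ^ m = ζ ^ l := by
    obtain ⟨k, hk⟩ := hml.dvd
    obtain rfl : l = m + n * k := by omega
    rw [zpow_add₀ (hprim.ne_zero hn.ne'), _root_.zpow_mul, zpow_natCast, zpow_natCast,
      hprim.pow_eq_one, _root_.one_zpow, mul_one]
  obtain ⟨hSG, hGS⟩ := hGal l hl (σ : ℂ →+* ℂ) (hσ.trans hζl)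
  have hTσ : T.map (σ : ℂ →+* ℂ) = T ^ l := by
    rw [hTdiag.map_eq_pow hTn hprim (σ : ℂ →+* ℂ) hσ, ← zpow_natCast,
      Matrix.zpow_eq_zpow_of_modEq hTu hTn hml]
  have hGu : IsUnit (G l).det := by
    rw [← hGS, Matrix.det_mul] at hSu
    exact isUnit_of_mul_isUnit_left hSu
  have hTG : SemiconjBy (G l) (T ^ (l ^ 2)) T := by
    rw [SemiconjBy, ← hGT l hl, Matrix.mul_assoc, Matrix.mul_nonsing_inv_cancel_left _ _ hGu]
  have hGTl : G l * T ^ l = T ^ lhat * G l := by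
    have h := Matrix.SemiconjBy.zpow_right (hTu.det_zpow _) hTu hTG lhat
    rw [← Matrix.zpow_mul _ hTu, Matrix.zpow_eq_zpow_of_modEq hTu hTN (b := l)] at h
    · exact h
    · simpa only [pow_two, mul_assoc, mul_one] using hlhat.mul_left l
  have hmap := congrArg (fun A : Matrix I I ℂ => A.map (σ : ℂ →+* ℂ)) hrel
  simp only [Matrix.map_mul, hTσ] at hmap
  have hSGl : T ^ l * S * T ^ lhat * S * T ^ l = S * G l := by
    calc
      _ = T ^ l * S * (T ^ lhat * G l) * S.map (σ : ℂ →+* ℂ) * T ^ l := by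
        nth_rewrite 2 [← hGS]
        simp only [Matrix.mul_assoc]
      _ = T ^ l * (S * G l) * T ^ l * S.map (σ : ℂ →+* ℂ) * T ^ l := by
        rw [← hGTl]
        simp only [Matrix.mul_assoc]
      _ = S * G l := by rw [← hSG, hmap]
  simp only [Matrix.mul_assoc] at hSGl ⊢
  rw [hSGl, Matrix.nonsing_inv_mul_cancel_left _ _ hSu]
end

section
/- Let ω₀ = T_{0,0} and let N₀ be the multiplicative order of the matrix ω₀^{−1}·T. Then ω₀^{12·N₀} = 1. (Writing ω₀ = exp(−2πi·c/24), this says that N₀ times the central charge c is an even integer.) -/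
open Matrix Complex

theorem nonempty_algHom_of_isTranscendenceBasis {F K L ι : Type*} [Field F] [Field K] [Field L]
    [Algebra F K] [Algebra F L] [IsAlgClosed L] {v : ι → K} {w : ι → L}
    (hv : IsTranscendenceBasis F v) (hw : AlgebraicIndependent F w) :
    Nonempty (K →ₐ[F] L) := by
  let φ : Algebra.adjoin F (Set.range v) →ₐ[F] L :=
    (MvPolynomial.aeval w).comp hv.1.aevalEquiv.symm.toAlgHom
  have hφ : Function.Injective φ := by
    have : Function.Injective (MvPolynomial.aeval w : MvPolynomial ι F →ₐ[F] L) := hw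
    exact this.comp hv.1.aevalEquiv.symm.injective
  let : Algebra (Algebra.adjoin F (Set.range v)) L := φ.toRingHom.toAlgebra
  have : FaithfulSMul (Algebra.adjoin F (Set.range v)) L :=
    (faithfulSMul_iff_algebraMap_injective _ _).2 hφ
  have : IsScalarTower F (Algebra.adjoin F (Set.range v)) L :=
    .of_algebraMap_eq fun x => (φ.commutes x).symm
  have := hv.isAlgebraic
  let e : K →ₐ[Algebra.adjoin F (Set.range v)] L := IsAlgClosed.lift
  exact ⟨e.restrictScalars F⟩

theorem exists_ringHom_comp_eq {F K : Type*} [Field F] [Algebra ℚ F] [Algebra.IsAlgebraic ℚ F]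
    [Field K] [Algebra ℚ K] [IsAlgClosed K] (f g : F →ₐ[ℚ] K) :
    ∃ σ : K →+* K, ∀ x, σ (f x) = g x := by
  obtain ⟨s, hs⟩ := exists_isTranscendenceBasis ℚ K
  have hf : letI := f.toRingHom.toAlgebra; IsTranscendenceBasis F ((↑) : s → K) := by
    let := f.toRingHom.toAlgebra
    have : IsScalarTower ℚ F K := .of_algebraMap_eq fun x => (f.commutes x).symm
    exact (Algebra.IsAlgebraic.isTranscendenceBasis_iff ℚ F).1 hs
  have hg : letI := g.toRingHom.toAlgebra; AlgebraicIndependent F ((↑) : s → K) := by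
    let := g.toRingHom.toAlgebra
    have : IsScalarTower ℚ F K := .of_algebraMap_eq fun x => (g.commutes x).symm
    exact hs.1.extendScalars F
  obtain ⟨e⟩ := @nonempty_algHom_of_isTranscendenceBasis F K K s _ _ _
    f.toRingHom.toAlgebra g.toRingHom.toAlgebra _ _ _ hf hg
  exact ⟨@AlgHom.toRingHom F K K _ _ _ f.toRingHom.toAlgebra g.toRingHom.toAlgebra e,
    fun x => @AlgHom.commutes F K K _ _ _ f.toRingHom.toAlgebra g.toRingHom.toAlgebra e x⟩

theorem IsPrimitiveRoot.exists_ringHom_apply_eq {n : ℕ} (hn : 0 < n) {ζ η : ℂ}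
    (hζ : IsPrimitiveRoot ζ n) (hη : IsPrimitiveRoot η n) :
    ∃ σ : ℂ →+* ℂ, σ ζ = η := by
  have hirr := Polynomial.cyclotomic.irreducible_rat hn
  have : Fact (Irreducible (Polynomial.cyclotomic n ℚ)) := ⟨hirr⟩
  have : Module.Finite ℚ (AdjoinRoot (Polynomial.cyclotomic n ℚ)) :=
    (Polynomial.cyclotomic.monic n ℚ).finite_adjoinRoot
  have root : ∀ {ξ : ℂ}, IsPrimitiveRoot ξ n →
      Polynomial.aeval ξ (Polynomial.cyclotomic n ℚ) = 0 := fun {ξ} h => by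
    have := h.isRoot_cyclotomic hn
    rwa [Polynomial.IsRoot, ← Polynomial.map_cyclotomic n (algebraMap ℚ ℂ),
      Polynomial.eval_map_algebraMap] at this
  obtain ⟨σ, hσ⟩ := exists_ringHom_comp_eq
    (AdjoinRoot.liftAlgHom (Polynomial.cyclotomic n ℚ) (Algebra.ofId ℚ ℂ) ζ (root hζ))
    (AdjoinRoot.liftAlgHom (Polynomial.cyclotomic n ℚ) (Algebra.ofId ℚ ℂ) η (root hη))
  refine ⟨σ, ?_⟩
  calc σ ζ = σ _ := congrArg σ (AdjoinRoot.liftAlgHom_root _ _ _ (root hζ)).symm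
    _ = _ := hσ (AdjoinRoot.root _)
    _ = η := AdjoinRoot.liftAlgHom_root _ _ _ (root hη)

/-- Let `c`, `c'` be the scalars by which a Galois automorphism scales `T` and by which
conjugation by the signed permutation matrix `G` scales `T`. Then `c ^ 6 = 1`. -/
theorem pow_six_eq_one_of_galois_scalar {I : Type*} [Fintype I] [DecidableEq I] [Nonempty I]
    {S T G : Matrix I I ℂ} {c c' : ℂ} {σ : ℂ →+* ℂ} (hc' : c' ≠ 0)
    (hS : IsUnit S) (hT : IsUnit T) (hrel : S * T * S * T * S * T = S * S)
    (hσS : S.map σ = S * G) (hG : G * (S * G) = S) (hσT : T.map σ = c • T)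
    (hTG : T * G = c' • (G * T)) (hsign : ∀ p, G p p = 0 ∨ G p p = 1 ∨ G p p = -1) :
    c ^ 6 = 1 := by
  have hσ := congrArg (fun M : Matrix I I ℂ => M.map σ) hrel
  simp only [Matrix.map_mul, hσS, hσT] at hσ
  have hGT : G * T = c'⁻¹ • (T * G) := by rw [hTG, smul_smul, inv_mul_cancel₀ hc', one_smul]
  have hrel' : ∀ X, S * (T * (S * (T * (S * (T * X))))) = S * (S * X) := fun X => by
    simpa only [Matrix.mul_assoc] using congrArg (· * X) hrel
  have key : (c ^ 3 * c'⁻¹ ^ 2) • (S * (S * G)) = S * S := by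
    simp only [Matrix.mul_assoc, Matrix.smul_mul, Matrix.mul_smul, hG, hGT,
      smul_smul, hrel'] at hσ
    rw [← hσ]
    congr 1
    ring
  have hGs : (c ^ 3 * c'⁻¹ ^ 2) • G = 1 := by
    apply hS.mul_left_cancel
    apply hS.mul_left_cancel
    simpa [Matrix.mul_smul] using key
  have i : I := Classical.arbitrary I
  set a := c ^ 3 * c'⁻¹ ^ 2 with ha
  have hai : a * G i i = 1 := by simpa using congrFun (congrFun hGs i) i
  have ha2 : a ^ 2 = 1 := by
    rcases hsign i with h | h | h <;> rw [h] at hai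
    · simp at hai
    · simp_all
    · have : a = -1 := by linear_combination -hai
      simp [this]
  have hc1 : c' = 1 := by
    have h1 : T = c' • T := by
      calc T = a • (T * G) := by rw [← Matrix.mul_smul, hGs, Matrix.mul_one]
        _ = c' • (a • G * T) := by rw [hTG, smul_comm, Matrix.smul_mul]
        _ = c' • T := by rw [hGs, Matrix.one_mul]
    have h2 : (1 : Matrix I I ℂ) = c' • 1 := by
      apply hT.mul_left_cancel
      simpa [Matrix.mul_smul] using h1
    simpa using (congrFun (congrFun h2 i) i).symm
  rw [ha, hc1] at ha2
  linear_combination ha2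

/-- Some `x` congruent to `1` modulo `k` has both `x - k` and `x + k` coprime to `n`. -/
theorem exists_isCoprime_sub_add (n k : ℕ) (hn : 0 < n) :
    ∃ x : ℤ, (k : ℤ) ∣ x - 1 ∧ IsCoprime (x - k) (n : ℤ) ∧ IsCoprime (x + k) (n : ℤ) := by
  let r := ∏ p ∈ n.primeFactors with ¬ p ∣ k, p
  have hr : IsCoprime (r : ℤ) (k : ℤ) := by
    rw [Nat.isCoprime_iff_coprime]
    refine Nat.Coprime.prod_left fun p hp => ?_
    rw [Finset.mem_filter] at hp
    exact ((Nat.prime_of_mem_primeFactors hp.1).coprime_iff_not_dvd).2 hp.2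
  obtain ⟨a, b, hab⟩ := hr
  have main : ∀ y : ℤ, ((k : ℤ) ∣ y - a * r) → (∀ q : ℤ, Prime q → q ∣ y → q ∣ a * r → q ∣ k) →
      IsCoprime y (n : ℤ) := by
    intro y hy hq
    refine isCoprime_of_prime_dvd (by rintro ⟨-, h⟩; omega) fun q hqp hqy hqn => ?_
    by_cases hqk : q ∣ (k : ℤ)
    · have h1 : q ∣ a * r := by simpa using dvd_sub hqy (hqk.trans hy)
      exact hqp.not_dvd_one (hab ▸ dvd_add h1 (hqk.mul_left b))
    · refine hqk (hq q hqp hqy (Dvd.dvd.mul_left ?_ a))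
      have hmem : q.natAbs ∈ n.primeFactors.filter (¬ · ∣ k) := by
        rw [Finset.mem_filter, Nat.mem_primeFactors]
        exact ⟨⟨Int.prime_iff_natAbs_prime.1 hqp, Int.natAbs_dvd_natAbs.2 hqn, hn.ne'⟩,
          fun h => hqk (Int.natAbs_dvd.1 (Int.natCast_dvd_natCast.2 h))⟩
      exact Int.natAbs_dvd.1 (Int.natCast_dvd_natCast.2 (Finset.dvd_prod_of_mem _ hmem))
  refine ⟨a * r, ⟨-b, by linear_combination hab⟩, main _ ⟨-1, by ring⟩ fun q _ h1 h2 => ?_,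
    main _ ⟨1, by ring⟩ fun q _ h1 h2 => ?_⟩
  · simpa using dvd_sub h2 h1
  · simpa using dvd_sub h1 h2

theorem stmt6
    {I : Type} [Fintype I] [DecidableEq I] [Nonempty I] (i0 : I)
    (ρ : SL2Z →* (Matrix I I ℂ)ˣ)
    (S T : Matrix I I ℂ)
    (hSdef : S = (↑(ρ sM) : Matrix I I ℂ)) (hTdef : T = (↑(ρ tM) : Matrix I I ℂ))
    (n N : ℕ) (hn : 0 < n) (hNpos : 0 < N) (hNdvd : N ∣ n)
    (hTdiag : T.IsDiag) (hTord : orderOf T = N)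
    (hSsymm : S.IsSymm) (hSunit : Sᴴ * S = 1)
    (ζ : ℂ) (hζ : ζ = Complex.exp (2 * Real.pi * Complex.I / n))
    (hSfield : ∀ p q, S p q ∈ IntermediateField.adjoin ℚ {ζ})
    (perm : ℤ → Equiv.Perm I) (ε : ℤ → I → ℂ) (G : ℤ → Matrix I I ℂ)
    (hε : ∀ l : ℤ, IsCoprime l (n : ℤ) → ∀ p, ε l p = 1 ∨ ε l p = -1)
    (hG : ∀ (l : ℤ) (p q : I), G l p q = ε l q * (if p = perm l q then 1 else 0))
    (hGal : ∀ l : ℤ, IsCoprime l (n : ℤ) → ∀ σ : ℂ →+* ℂ, σ ζ = ζ ^ l →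
      S.map σ = S * G l ∧ G l * S.map σ = S)
    (hGT : ∀ l : ℤ, IsCoprime l (n : ℤ) → (G l)⁻¹ * T * G l = T ^ (l ^ 2 : ℤ))
    (hSpos : ∀ p, ∃ r : ℝ, 0 < r ∧ S i0 p = (r : ℂ))
    (N0 : ℕ) (hN0 : orderOf ((T i0 i0)⁻¹ • T) = N0) :
    (T i0 i0) ^ (12 * N0) = 1 := by
  have hζp : IsPrimitiveRoot ζ n := hζ ▸ Complex.isPrimitiveRoot_exp n hn.ne'
  have hSu : IsUnit S := hSdef ▸ (ρ sM).isUnit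
  have hTu : IsUnit T := hTdef ▸ (ρ tM).isUnit
  have hrel : S * T * S * T * S * T = S * S := by
    have h : sM * tM * sM * tM * sM * tM = sM * sM := by decide
    rw [hSdef, hTdef]
    simpa using congrArg (fun g => ((ρ g : (Matrix I I ℂ)ˣ) : Matrix I I ℂ)) h
  obtain ⟨d, hd⟩ : ∃ d : I → ℂ, T = Matrix.diagonal d := ⟨T.diag, hTdiag.diagonal_diag.symm⟩
  have hTn : T ^ n = 1 := orderOf_dvd_iff_pow_eq_one.1 (hTord ▸ hNdvd)
  have hdn : ∀ p, d p ^ n = 1 := fun p => by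
    rw [hd, Matrix.diagonal_pow] at hTn
    simpa using congrFun (congrFun hTn p) p
  have hd0 : ∀ p, d p ≠ 0 := fun p h => by simpa [h, hn.ne'] using hdn p
  have hω : T i0 i0 = d i0 := by simp [hd]
  have hquot : ∀ p, ((d i0)⁻¹ * d p) ^ N0 = 1 := fun p => by
    have h := pow_orderOf_eq_one ((T i0 i0)⁻¹ • T)
    rw [hN0, hω, hd, ← Matrix.diagonal_smul, Matrix.diagonal_pow] at h
    simpa using congrFun (congrFun h p) p
  have hpow : ∀ l : ℤ, (N0 : ℤ) ∣ l - 1 → ∀ p, d p ^ l = d i0 ^ (l - 1) * d p := by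
    rintro l ⟨m, hm⟩ p
    have h : ((d i0)⁻¹ * d p) ^ (l - 1) = 1 := by
      rw [hm, _root_.zpow_mul, zpow_natCast, hquot, _root_.one_zpow]
    rw [mul_zpow, _root_.inv_zpow, inv_mul_eq_one₀ (zpow_ne_zero _ (hd0 _))] at h
    rw [h, ← zpow_add_one₀ (hd0 p), sub_add_cancel]
  have key : ∀ l : ℤ, IsCoprime l (n : ℤ) → (N0 : ℤ) ∣ l - 1 → (d i0 ^ (l - 1)) ^ 6 = 1 := by
    intro l hl hlN
    obtain ⟨σ, hσ⟩ := hζp.exists_ringHom_apply_eq hn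
      (hζp.zpow_of_gcd_eq_one l (Int.isCoprime_iff_gcd_eq_one.1 hl))
    obtain ⟨hσS, hGS⟩ := hGal l hl σ hσ
    have hσT : T.map σ = d i0 ^ (l - 1) • T := by
      have hσd : ∀ p, σ (d p) = d p ^ l := fun p => by
        have : NeZero n := ⟨hn.ne'⟩
        obtain ⟨k, -, hk⟩ := hζp.eq_pow_of_pow_eq_one (hdn p)
        rw [← hk, map_pow, hσ, ← zpow_natCast, ← zpow_natCast, zpow_comm]
      rw [hd, Matrix.diagonal_map (map_zero σ), ← Matrix.diagonal_smul]
      congr 1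
      ext p
      simp [hσd, hpow l hlN]
    have hTsq : T ^ (l ^ 2 : ℤ) = d i0 ^ (l ^ 2 - 1) • T := by
      have hl2 : (N0 : ℤ) ∣ l ^ 2 - 1 := by
        have := hlN.mul_right (l + 1)
        rwa [show (l - 1) * (l + 1) = l ^ 2 - 1 by ring] at this
      have hnat : ((l.natAbs ^ 2 : ℕ) : ℤ) = l ^ 2 := by simp
      have hp := hpow _ hl2
      rw [← hnat, zpow_natCast, hd, Matrix.diagonal_pow, ← Matrix.diagonal_smul]
      congr 1
      ext p
      rw [hnat, Pi.smul_apply, smul_eq_mul, ← hp, Pi.pow_apply, ← zpow_natCast, hnat]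
    have hGu : IsUnit (G l).det := by
      have h : IsUnit (G l * S.map σ) := by rwa [hGS]
      rw [Matrix.isUnit_iff_isUnit_det, Matrix.det_mul] at h
      exact isUnit_of_mul_isUnit_left h
    have hTG : T * G l = d i0 ^ (l ^ 2 - 1) • (G l * T) := by
      rw [← Matrix.mul_smul, ← hTsq, ← hGT l hl, Matrix.mul_assoc,
        Matrix.mul_nonsing_inv_cancel_left _ _ hGu]
    have : Nonempty I := ⟨i0⟩
    refine pow_six_eq_one_of_galois_scalar (zpow_ne_zero _ (hd0 i0)) hSu hTu hrel hσS
      (hσS ▸ hGS) hσT hTG fun p => ?_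
    rw [hG]
    split_ifs
    · exact .inr (by simpa using hε l hl p)
    · simp
  obtain ⟨x, hx, hsub, hadd⟩ := exists_isCoprime_sub_add n N0 hn
  have h1 := key _ hsub (by rw [sub_right_comm]; exact dvd_sub hx dvd_rfl)
  have h2 := key _ hadd (by rw [add_sub_right_comm]; exact dvd_add hx dvd_rfl)
  rw [hω]
  calc d i0 ^ (12 * N0) = (d i0 ^ (x + N0 - 1)) ^ 6 / (d i0 ^ (x - N0 - 1)) ^ 6 := by
        rw [← zpow_natCast, ← zpow_natCast, ← zpow_natCast, ← _root_.zpow_mul, ← _root_.zpow_mul,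
          ← zpow_sub₀ (hd0 i0)]
        congr 1
        push_cast
        ring
    _ = 1 := by rw [h1, h2, div_one]
end

section
/- Let s be the exponent of the symmetric group of the set I. Then l^{2s} ≡ 1 (mod N) for every integer l coprime to N; equivalently, the exponent of the unit group (ℤ/Nℤ)ˣ divides 2s. Consequently the order N of T divides a bound depending only on the cardinality of I, so for a given number of primary fields only finitely many values of N can occur. -/
open Matrix Complex

/-- If `G` is a monomial matrix with underlying permutation `e` and signs `c`, then conjugating a
diagonal matrix by `G` permutes the diagonal entries by `e`. -/
theorem monomial_conj_diagonal_apply {I : Type*} [Fintype I] [DecidableEq I] (e : Equiv.Perm I)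
    (c : I → ℂ) (hc : ∀ p, c p = 1 ∨ c p = -1) (G : Matrix I I ℂ)
    (hG : ∀ p q, G p q = c q * (if p = e q then 1 else 0)) (d : I → ℂ) (q : I) :
    (G⁻¹ * diagonal d * G) q q = d (e q) := by
  have hsq : ∀ p, c p * c p = 1 := fun p => by rcases hc p with h | h <;> simp [h]
  have hinv : G⁻¹ = Gᵀ := by
    refine inv_eq_left_inv ?_
    ext p r
    by_cases hpr : p = r
    · subst hpr
      simp [mul_apply, hG, hsq]
    · simp [mul_apply, hG, hpr, Ne.symm hpr, one_apply]
  rw [hinv, mul_assoc]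
  simp only [mul_apply, transpose_apply, hG, mul_ite, ite_mul, mul_one, mul_zero, zero_mul,
    Finset.sum_ite_eq', Finset.mem_univ, if_true, diagonal_apply_eq]
  linear_combination d (e q) * hsq q

/-- If a permutation of the index set raises a function to its `k`-th power, then its `j`-th
iterate raises it to the power `k ^ j`. -/
theorem apply_perm_pow_eq_pow {I M : Type*} [Monoid M] (e : Equiv.Perm I) (d : I → M) (k : ℕ)
    (h : ∀ q, d (e q) = d q ^ k) (j : ℕ) (q : I) : d ((e ^ j) q) = d q ^ k ^ j := by
  induction j with
  | zero => simp
  | succ j ih => rw [pow_succ' e, Equiv.Perm.mul_apply, h, ih, ← pow_mul, pow_succ]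

/-- If a permutation of the index set raises the entries of `d` to their `k`-th powers, then
`k ^ exponent (Perm I)` is congruent to `1` modulo the order of `diagonal d`. -/
theorem pow_exponent_perm_modEq_one {I R : Type*} [Fintype I] [DecidableEq I] [CommSemiring R]
    (e : Equiv.Perm I) (d : I → R) (k : ℕ) (h : ∀ q, d (e q) = d q ^ k)
    (hd : IsOfFinOrder (diagonal d)) :
    k ^ Monoid.exponent (Equiv.Perm I) ≡ 1 [MOD orderOf (diagonal d)] := by
  rw [← hd.pow_eq_pow_iff_modEq, pow_one, diagonal_pow]
  congr 1
  funext q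
  have := apply_perm_pow_eq_pow e d k h (Monoid.exponent (Equiv.Perm I)) q
  rw [Monoid.pow_exponent_eq_one, Equiv.Perm.one_apply] at this
  exact this.symm

/-- A number coprime to `d` has `e`-th power `1` modulo `d`, where `e` is any multiple of the
exponent of the unit group of `ZMod d`. -/
theorem dvd_pow_sub_one_of_exponent_units_dvd {d e a : ℕ}
    (he : Monoid.exponent (ZMod d)ˣ ∣ e) (ha : a.Coprime d) : d ∣ a ^ e - 1 := by
  rcases a.eq_zero_or_pos with rfl | hpos
  · simp [(Nat.coprime_zero_left d).1 ha]
  rw [← Nat.modEq_iff_dvd' (Nat.one_le_pow _ _ hpos), ← ZMod.natCast_eq_natCast_iff]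
  have := congrArg Units.val
    (Monoid.exponent_dvd_iff_forall_pow_eq_one.1 he (ZMod.unitOfCoprime a ha))
  simpa using this.symm

/-- The exponent of the unit group of `ZMod d` is monotone with respect to divisibility. -/
theorem exponent_units_zmod_dvd {d M : ℕ} (hM : 0 < M) (h : d ∣ M) :
    Monoid.exponent (ZMod d)ˣ ∣ Monoid.exponent (ZMod M)ˣ := by
  have : NeZero M := ⟨hM.ne'⟩
  exact MonoidHom.exponent_dvd (ZMod.unitsMap_surjective h)

/-- Only finitely many moduli have a unit group whose exponent divides a given positive number. -/
theorem finite_setOf_exponent_units_zmod_dvd {e : ℕ} (he : 0 < e) :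
    {M : ℕ | 0 < M ∧ Monoid.exponent (ZMod M)ˣ ∣ e}.Finite := by
  refine (Set.finite_Iic ((3 ^ e - 1) * (2 ^ e - 1))).subset ?_
  rintro M ⟨hM, hMe⟩
  obtain ⟨k, m, hm, rfl⟩ := Nat.exists_eq_two_pow_mul_odd hM.ne'
  have h3 : 2 ^ k ∣ 3 ^ e - 1 := dvd_pow_sub_one_of_exponent_units_dvd
    ((exponent_units_zmod_dvd hM (Dvd.intro _ rfl)).trans hMe)
    (Nat.Coprime.pow_right k (by norm_num))
  have h2 : m ∣ 2 ^ e - 1 := dvd_pow_sub_one_of_exponent_units_dvd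
    ((exponent_units_zmod_dvd hM (Dvd.intro_left _ rfl)).trans hMe)
    (Nat.coprime_two_left.2 hm)
  have h3e := Nat.one_lt_pow he.ne' (by norm_num : 1 < 3)
  have h2e := Nat.one_lt_pow he.ne' (by norm_num : 1 < 2)
  exact Nat.mul_le_mul (Nat.le_of_dvd (by omega) h3) (Nat.le_of_dvd (by omega) h2)

theorem stmt7
    {I : Type} [Fintype I] [DecidableEq I] [Nonempty I] (i0 : I)
    (ρ : SL2Z →* (Matrix I I ℂ)ˣ)
    (S T : Matrix I I ℂ)
    (hSdef : S = (↑(ρ sM) : Matrix I I ℂ)) (hTdef : T = (↑(ρ tM) : Matrix I I ℂ))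
    (n N : ℕ) (hn : 0 < n) (hNpos : 0 < N) (hNdvd : N ∣ n)
    (hTdiag : T.IsDiag) (hTord : orderOf T = N)
    (hSsymm : S.IsSymm) (hSunit : Sᴴ * S = 1)
    (ζ : ℂ) (hζ : ζ = Complex.exp (2 * Real.pi * Complex.I / n))
    (hSfield : ∀ p q, S p q ∈ IntermediateField.adjoin ℚ {ζ})
    (perm : ℤ → Equiv.Perm I) (ε : ℤ → I → ℂ) (G : ℤ → Matrix I I ℂ)
    (hε : ∀ l : ℤ, IsCoprime l (n : ℤ) → ∀ p, ε l p = 1 ∨ ε l p = -1)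
    (hG : ∀ (l : ℤ) (p q : I), G l p q = ε l q * (if p = perm l q then 1 else 0))
    (hGal : ∀ l : ℤ, IsCoprime l (n : ℤ) → ∀ σ : ℂ →+* ℂ, σ ζ = ζ ^ l →
      S.map σ = S * G l ∧ G l * S.map σ = S)
    (hGT : ∀ l : ℤ, IsCoprime l (n : ℤ) → (G l)⁻¹ * T * G l = T ^ (l ^ 2 : ℤ))
    (hSpos : ∀ p, ∃ r : ℝ, 0 < r ∧ S i0 p = (r : ℂ)) :
    (∀ l : ℤ, IsCoprime l (N : ℤ) →
        l ^ (2 * Monoid.exponent (Equiv.Perm I)) ≡ 1 [ZMOD (N : ℤ)]) ∧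
    Monoid.exponent ((ZMod N)ˣ) ∣ 2 * Monoid.exponent (Equiv.Perm I) ∧
    {M : ℕ | 0 < M ∧ Monoid.exponent ((ZMod M)ˣ) ∣ 2 * Monoid.exponent (Equiv.Perm I)}.Finite ∧
    N ∈ {M : ℕ | 0 < M ∧ Monoid.exponent ((ZMod M)ˣ) ∣ 2 * Monoid.exponent (Equiv.Perm I)} := by
  have : NeZero n := ⟨hn.ne'⟩
  obtain ⟨d, rfl⟩ : ∃ d, T = diagonal d := ⟨_, hTdiag.diagonal_diag.symm⟩
  have hfin : IsOfFinOrder (diagonal d) := orderOf_pos_iff.1 (hTord ▸ hNpos)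
  have hpow : ∀ m : ℕ, m.Coprime n →
      m ^ (2 * Monoid.exponent (Equiv.Perm I)) ≡ 1 [MOD N] := by
    intro m hm
    have hml : IsCoprime (m : ℤ) (n : ℤ) := Nat.isCoprime_iff_coprime.2 hm
    rw [pow_mul, ← hTord]
    refine pow_exponent_perm_modEq_one (perm m) d (m ^ 2) (fun q => ?_) hfin
    have h := congrFun (congrFun (hGT m hml) q) q
    rw [monomial_conj_diagonal_apply (perm m) (ε m) (hε m hml) (G m) (hG m),
      ← Nat.cast_pow, zpow_natCast, diagonal_pow, diagonal_apply_eq] at h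
    exact h
  have hexp : Monoid.exponent ((ZMod N)ˣ) ∣ 2 * Monoid.exponent (Equiv.Perm I) := by
    refine Monoid.exponent_dvd_of_forall_pow_eq_one fun u => ?_
    obtain ⟨v, rfl⟩ := ZMod.unitsMap_surjective hNdvd u
    have hv := (ZMod.natCast_eq_natCast_iff _ _ _).2 (hpow _ (ZMod.val_coe_unit_coprime v))
    ext
    simpa [ZMod.unitsMap_val] using hv
  refine ⟨fun l hl => ?_, hexp,
    finite_setOf_exponent_units_zmod_dvd (mul_pos two_pos ?_), hNpos, hexp⟩
  · obtain ⟨u, hu⟩ := (ZMod.coe_int_isUnit_iff_isCoprime l N).2 hl.symm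
    have h := congrArg Units.val (Monoid.exponent_dvd_iff_forall_pow_eq_one.1 hexp u)
    rw [← ZMod.intCast_eq_intCast_iff]
    simpa [hu] using h
  · exact Nat.pos_of_ne_zero Monoid.exponent_ne_zero_of_finite
end

section
/- Let l be coprime to n·c and suppose given diagonal matrices Z_l(a/c), indexed by integers a, each of multiplicative order dividing c, such that G_l^{−1}·T^{a/c}·G_l = T^{(l²a)/c}·Z_l(a/c)^l for every integer a. Then Z_l(a₁/c)·Z_l(a₂/c) = Z_l((a₁+a₂)/c) for all integers a₁, a₂. -/
open Matrix Complex

/-- A signed permutation matrix has its transpose as a left inverse. -/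
theorem transpose_mul_self_of_signed_perm {I R : Type*} [Fintype I] [DecidableEq I] [CommRing R]
    (π : Equiv.Perm I) (ε : I → R) (hε : ∀ p, ε p = 1 ∨ ε p = -1) (G : Matrix I I R)
    (hG : ∀ p q, G p q = ε q * (if p = π q then 1 else 0)) : Gᵀ * G = 1 := by
  ext q r
  simp only [Matrix.mul_apply, Matrix.transpose_apply, hG, Matrix.one_apply]
  rw [Finset.sum_eq_single (π q) (by intro p _ hp; simp [hp]) (by simp)]
  rcases eq_or_ne q r with rfl | h
  · rcases hε q with h | h <;> simp [h]
  · simp [h]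

theorem Matrix.IsDiag.commute {I R : Type*} [Fintype I] [DecidableEq I] [CommRing R]
    {A B : Matrix I I R} (hA : A.IsDiag) (hB : B.IsDiag) : Commute A B := by
  rw [← hA.diagonal_diag, ← hB.diagonal_diag]
  exact Matrix.commute_diagonal _ _

/-- Among matrices of order dividing `c`, taking `l`-th powers is injective if `l` is coprime
to `c`. -/
theorem Matrix.eq_of_zpow_eq_of_isCoprime {I R : Type*} [Fintype I] [DecidableEq I] [CommRing R]
    {c : ℕ} (hc : c ≠ 0) {l : ℤ} (hl : IsCoprime l (c : ℤ)) {A B : Matrix I I R}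
    (hA : A ^ c = 1) (hB : B ^ c = 1) (h : A ^ l = B ^ l) : A = B := by
  obtain ⟨u, v, huv⟩ := hl
  have key : ∀ W : Matrix I I R, W ^ c = 1 → (W ^ l) ^ u = W := by
    intro W hW
    have hdet : IsUnit W.det :=
      (Matrix.isUnit_iff_isUnit_det _).1 (IsUnit.of_pow_eq_one hW hc)
    calc (W ^ l) ^ u = W ^ (l * u) * (W ^ (c : ℤ)) ^ v := by
          rw [zpow_natCast, hW, Matrix.one_zpow, mul_one, Matrix.zpow_mul _ hdet]
      _ = W ^ (1 : ℤ) := by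
          rw [← Matrix.zpow_mul _ hdet, ← Matrix.zpow_add hdet, ← huv]
          congr 1
          ring
      _ = W := zpow_one W
  rw [← key A hA, ← key B hB, h]

theorem stmt9
    {I : Type} [Fintype I] [DecidableEq I] [Nonempty I] (i0 : I)
    (ρ : SL2Z →* (Matrix I I ℂ)ˣ)
    (S T : Matrix I I ℂ)
    (hSdef : S = (↑(ρ sM) : Matrix I I ℂ)) (hTdef : T = (↑(ρ tM) : Matrix I I ℂ))
    (n N : ℕ) (hn : 0 < n) (hNpos : 0 < N) (hNdvd : N ∣ n)
    (hTdiag : T.IsDiag) (hTord : orderOf T = N)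
    (hSsymm : S.IsSymm) (hSunit : Sᴴ * S = 1)
    (ζ : ℂ) (hζ : ζ = Complex.exp (2 * Real.pi * Complex.I / n))
    (hSfield : ∀ p q, S p q ∈ IntermediateField.adjoin ℚ {ζ})
    (perm : ℤ → Equiv.Perm I) (ε : ℤ → I → ℂ) (G : ℤ → Matrix I I ℂ)
    (hε : ∀ l : ℤ, IsCoprime l (n : ℤ) → ∀ p, ε l p = 1 ∨ ε l p = -1)
    (hG : ∀ (l : ℤ) (p q : I), G l p q = ε l q * (if p = perm l q then 1 else 0))
    (hGal : ∀ l : ℤ, IsCoprime l (n : ℤ) → ∀ σ : ℂ →+* ℂ, σ ζ = ζ ^ l →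
      S.map σ = S * G l ∧ G l * S.map σ = S)
    (c : ℕ) (hc : 0 < c)
    (X : Matrix I I ℂ) (hXdiag : X.IsDiag) (hXpow : X ^ (c : ℕ) = T)
    (hXroot : ∀ p, X p p ^ n = 1)
    (l : ℤ) (hl : IsCoprime l ((n : ℤ) * c))
    (Z : ℤ → Matrix I I ℂ)
    (hZdiag : ∀ a : ℤ, (Z a).IsDiag) (hZord : ∀ a : ℤ, Z a ^ (c : ℕ) = 1)
    (hcomm : ∀ a : ℤ, (G l)⁻¹ * X ^ a * G l = X ^ (l ^ 2 * a) * (Z a) ^ l) :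
    ∀ a₁ a₂ : ℤ, Z a₁ * Z a₂ = Z (a₁ + a₂) := by
  intro a₁ a₂
  have hGl : IsUnit (G l).det :=
    Matrix.isUnit_det_of_left_inverse <| transpose_mul_self_of_signed_perm (perm l) (ε l)
      (hε l hl.of_mul_right_left) (G l) (hG l)
  have hX : IsUnit X.det := by
    rw [← Matrix.isUnit_iff_isUnit_det, ← isUnit_pow_iff hc.ne', hXpow, hTdef]
    exact Units.isUnit _
  have hZZ : Commute (Z a₁) (Z a₂) := (hZdiag a₁).commute (hZdiag a₂)
  refine Matrix.eq_of_zpow_eq_of_isCoprime hc.ne' hl.of_mul_right_right ?_ (hZord _) ?_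
  · rw [hZZ.mul_pow, hZord, hZord, one_mul]
  have hXu : IsUnit (X ^ (l ^ 2 * (a₁ + a₂))) :=
    (Matrix.isUnit_iff_isUnit_det _).2 (Matrix.isUnit_det_zpow_iff.2 (Or.inl hX))
  have hXZ : Commute (Z a₁ ^ l) (X ^ (l ^ 2 * a₂)) :=
    Matrix.Commute.zpow_zpow ((hZdiag a₁).commute hXdiag) _ _
  apply hXu.mul_left_cancel
  calc X ^ (l ^ 2 * (a₁ + a₂)) * (Z a₁ * Z a₂) ^ l
      = X ^ (l ^ 2 * a₁) * (X ^ (l ^ 2 * a₂) * Z a₁ ^ l) * Z a₂ ^ l := by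
        rw [Matrix.Commute.mul_zpow hZZ, mul_add, Matrix.zpow_add hX]
        simp only [mul_assoc]
    _ = (X ^ (l ^ 2 * a₁) * Z a₁ ^ l) * (X ^ (l ^ 2 * a₂) * Z a₂ ^ l) := by
        rw [← hXZ.eq]
        simp only [mul_assoc]
    _ = (G l)⁻¹ * X ^ a₁ * (G l * (G l)⁻¹) * X ^ a₂ * G l := by
        rw [← hcomm, ← hcomm]
        simp only [mul_assoc]
    _ = (G l)⁻¹ * X ^ (a₁ + a₂) * G l := by
        rw [Matrix.mul_nonsing_inv _ hGl, mul_one, Matrix.zpow_add hX]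
        simp only [mul_assoc]
    _ = X ^ (l ^ 2 * (a₁ + a₂)) * Z (a₁ + a₂) ^ l := hcomm _
end

section
/- Let m = [[a,b],[c,d]] ∈ SL(2,ℤ) (with the same c ≥ 1 as in the definition of Λ), let l be coprime to n·c, and let k, α be integers with l·k = 1 + α·c. Set m̂ = [[l·a, b+α·a·d],[c, k·d]], which lies in SL(2,ℤ). Suppose there are diagonal matrices Z_l(u/c) for u ∈ ℤ, each of multiplicative order dividing c and depending only on u modulo c, such that: (i) σ_l(Λ(a/c)) = Λ(la/c)·G_l·Z_l(d/c); (ii) G_l^{−1}·T^{u/c}·G_l = T^{(l²u)/c}·Z_l(u/c)^l for all u; (iii) Z_l(u₁/c)·Z_l(u₂/c) = Z_l((u₁+u₂)/c) for all u₁, u₂. Then σ_l(ρ(m)) = ρ(m̂)·G_l·T^{−α·l·d}. -/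
open Matrix Complex

/-- Integer powers of an invertible diagonal matrix are computed entrywise. -/
theorem diagonal_zpow_of_ne_zero {I K : Type*} [Fintype I] [DecidableEq I] [Field K]
    (v : I → K) (hv : ∀ i, v i ≠ 0) (u : ℤ) :
    (diagonal v) ^ u = diagonal (fun i => v i ^ u) := by
  have hnat : ∀ m : ℕ, (diagonal v) ^ m = diagonal (fun i => v i ^ m) := fun m => by
    rw [diagonal_pow]; rfl
  cases u with
  | ofNat m => simpa using hnat m
  | negSucc m =>
    rw [zpow_negSucc, hnat]
    refine Matrix.inv_eq_left_inv ?_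
    rw [diagonal_mul_diagonal, ← diagonal_one]
    congr 1
    funext i
    rw [zpow_negSucc]
    exact inv_mul_cancel₀ (pow_ne_zero _ (hv i))

/-- A field endomorphism raising a primitive `n`-th root of unity to the `l`-th power acts on
every diagonal matrix of `n`-th roots of unity as the `l`-th power. -/
theorem map_zpow_of_isDiag_of_pow_eq_one {I K : Type*} [Fintype I] [DecidableEq I] [Field K]
    {n : ℕ} (hn : 0 < n) {ζ : K} (hζ : IsPrimitiveRoot ζ n) {X : Matrix I I K}
    (hX : X.IsDiag) (hroot : ∀ p, X p p ^ n = 1) {l : ℤ} {σ : K →+* K}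
    (hσ : σ ζ = ζ ^ l) (u : ℤ) : (X ^ u).map σ = X ^ (l * u) := by
  have hv : ∀ p, X.diag p ≠ 0 := fun p h => by
    have := hroot p
    rw [show X p p = 0 from h, zero_pow hn.ne'] at this
    exact zero_ne_one this
  have : NeZero n := ⟨hn.ne'⟩
  rw [← hX.diagonal_diag, diagonal_zpow_of_ne_zero _ hv, diagonal_zpow_of_ne_zero _ hv,
    diagonal_map (map_zero σ)]
  congr 1
  funext p
  obtain ⟨j, -, hj⟩ := hζ.eq_pow_of_pow_eq_one (hroot p)
  have hp : X.diag p = ζ ^ j := hj.symm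
  rw [map_zpow₀, _root_.zpow_mul, hp, map_pow, hσ, ← zpow_natCast, ← zpow_natCast,
    zpow_comm ζ]

/-- A family of invertible matrices that is additive in an integer index is compatible with
integer powers. -/
theorem zpow_eq_of_mul_eq_add {I K : Type*} [Fintype I] [DecidableEq I] [Field K]
    {Z : ℤ → Matrix I I K} (hunit : ∀ u, IsUnit (Z u))
    (hadd : ∀ u₁ u₂ : ℤ, Z u₁ * Z u₂ = Z (u₁ + u₂)) (u l : ℤ) : Z u ^ l = Z (l * u) := by
  have h0 : Z 0 = 1 := by
    have h := hadd 0 0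
    rw [add_zero] at h
    exact (hunit 0).mul_left_cancel (by rw [h, mul_one])
  have hnat : ∀ m : ℕ, Z u ^ m = Z (m * u) := fun m => by
    induction m with
    | zero => simp [h0]
    | succ m ih => rw [pow_succ, ih, hadd]; congr 1; push_cast; ring
  cases l with
  | ofNat m => simpa using hnat m
  | negSucc m =>
    rw [zpow_negSucc, hnat]
    refine Matrix.inv_eq_left_inv ?_
    rw [hadd, ← h0]
    congr 1
    rw [Int.negSucc_eq]
    push_cast
    ring

theorem stmt10
    {I : Type} [Fintype I] [DecidableEq I] [Nonempty I] (i0 : I)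
    (ρ : SL2Z →* (Matrix I I ℂ)ˣ)
    (S T : Matrix I I ℂ)
    (hSdef : S = (↑(ρ sM) : Matrix I I ℂ)) (hTdef : T = (↑(ρ tM) : Matrix I I ℂ))
    (n N : ℕ) (hn : 0 < n) (hNpos : 0 < N) (hNdvd : N ∣ n)
    (hTdiag : T.IsDiag) (hTord : orderOf T = N)
    (hSsymm : S.IsSymm) (hSunit : Sᴴ * S = 1)
    (ζ : ℂ) (hζ : ζ = Complex.exp (2 * Real.pi * Complex.I / n))
    (hSfield : ∀ p q, S p q ∈ IntermediateField.adjoin ℚ {ζ})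
    (perm : ℤ → Equiv.Perm I) (ε : ℤ → I → ℂ) (G : ℤ → Matrix I I ℂ)
    (hε : ∀ l : ℤ, IsCoprime l (n : ℤ) → ∀ p, ε l p = 1 ∨ ε l p = -1)
    (hG : ∀ (l : ℤ) (p q : I), G l p q = ε l q * (if p = perm l q then 1 else 0))
    (hGal : ∀ l : ℤ, IsCoprime l (n : ℤ) → ∀ σ : ℂ →+* ℂ, σ ζ = ζ ^ l →
      S.map σ = S * G l ∧ G l * S.map σ = S)
    (hGT : ∀ l : ℤ, IsCoprime l (n : ℤ) → (G l)⁻¹ * T * G l = T ^ (l ^ 2 : ℤ))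
    (c : ℕ) (hc : 0 < c)
    (X : Matrix I I ℂ) (hXdiag : X.IsDiag) (hXpow : X ^ (c : ℕ) = T)
    (hXroot : ∀ p, X p p ^ n = 1)
    (Λ : ℤ → Matrix I I ℂ)
    (hΛ : ∀ (k x y : ℤ) (h : k * x - y * (c : ℤ) = 1),
      Λ k = X ^ (-k) *
        (↑(ρ ⟨!![k, y; (c : ℤ), x], by rw [Matrix.det_fin_two_of]; linarith⟩) : Matrix I I ℂ) *
        X ^ (-x))
    (a b d l k α : ℤ) (hdet : a * d - b * (c : ℤ) = 1)
    (hl : IsCoprime l ((n : ℤ) * c)) (hk : l * k = 1 + α * c)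
    (Z : ℤ → Matrix I I ℂ)
    (hZdiag : ∀ u : ℤ, (Z u).IsDiag) (hZord : ∀ u : ℤ, Z u ^ (c : ℕ) = 1)
    (hZmod : ∀ u u' : ℤ, u ≡ u' [ZMOD (c : ℤ)] → Z u = Z u')
    (hi : ∀ σ : ℂ →+* ℂ, σ ζ = ζ ^ l → (Λ a).map σ = Λ (l * a) * G l * Z d)
    (hii : ∀ u : ℤ, (G l)⁻¹ * X ^ u * G l = X ^ (l ^ 2 * u) * (Z u) ^ l)
    (hiii : ∀ u₁ u₂ : ℤ, Z u₁ * Z u₂ = Z (u₁ + u₂)) :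
    ∀ σ : ℂ →+* ℂ, σ ζ = ζ ^ l →
      ((↑(ρ ⟨!![a, b; (c : ℤ), d], by rw [Matrix.det_fin_two_of]; linarith⟩) :
          Matrix I I ℂ)).map σ =
        (↑(ρ ⟨!![l * a, b + α * a * d; (c : ℤ), k * d],
            by rw [Matrix.det_fin_two_of]; linear_combination a * d * hk + hdet⟩) :
          Matrix I I ℂ) * G l * T ^ (-(α * l * d)) := by
  intro σ hσ
  have hprim : IsPrimitiveRoot ζ n := hζ ▸ Complex.isPrimitiveRoot_exp n hn.ne'
  have hXn : X ^ n = 1 := by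
    rw [← hXdiag.diagonal_diag, diagonal_pow, ← diagonal_one]
    congr 1
    funext p
    exact hXroot p
  have hXdet : IsUnit X.det :=
    (Matrix.isUnit_iff_isUnit_det X).mp (IsUnit.of_pow_eq_one hXn hn.ne')
  have hZunit : ∀ u, IsUnit (Z u) := fun u => IsUnit.of_pow_eq_one (hZord u) hc.ne'
  have hGdet : IsUnit (G l).det := by
    have h := (hGal l (hl.of_mul_right_left) σ hσ).2
    refine Matrix.isUnit_det_of_right_inverse (B := S.map σ * Sᴴ) ?_
    rw [← Matrix.mul_assoc, h]
    exact mul_eq_one_comm.mp hSunit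
  have hXmap := map_zpow_of_isDiag_of_pow_eq_one hn hprim hXdiag hXroot hσ
  have hTX : ∀ u : ℤ, T ^ u = X ^ ((c : ℤ) * u) := fun u => by
    rw [← hXpow, Matrix.zpow_mul X hXdet, zpow_natCast]
  have hfactor : ∀ (e x y : ℤ) (h : e * x - y * (c : ℤ) = 1),
      (↑(ρ ⟨!![e, y; (c : ℤ), x], by rw [Matrix.det_fin_two_of]; linarith⟩) :
        Matrix I I ℂ) = X ^ e * Λ e * X ^ x := fun e x y h => by
    have hcancel : ∀ u : ℤ, X ^ u * X ^ (-u) = 1 := fun u => by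
      rw [← Matrix.zpow_add hXdet, add_neg_cancel, zpow_zero]
    have hcancel' : X ^ (-x) * X ^ x = 1 := by
      rw [← Matrix.zpow_add hXdet, neg_add_cancel, zpow_zero]
    rw [hΛ e x y h, Matrix.mul_assoc (X ^ (-e)), ← Matrix.mul_assoc (X ^ e), hcancel,
      Matrix.one_mul, Matrix.mul_assoc, hcancel', Matrix.mul_one]
  have hZl : Z (k * d) ^ l = Z d := by
    rw [zpow_eq_of_mul_eq_add hZunit hiii]
    refine hZmod _ _ ((Int.modEq_iff_dvd.mpr ⟨-(α * d), ?_⟩))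
    linear_combination -d * hk
  have hcomm : Commute (Z d) (X ^ (-((c : ℤ) * (α * l * d)))) := by
    refine Matrix.Commute.zpow_right ?_ _
    rw [← (hZdiag d).diagonal_diag, ← hXdiag.diagonal_diag]
    exact commute_diagonal _ _
  have hcommd : Commute (Z d) (X ^ (l * d)) := by
    refine Matrix.Commute.zpow_right ?_ _
    rw [← (hZdiag d).diagonal_diag, ← hXdiag.diagonal_diag]
    exact commute_diagonal _ _
  have hmove : X ^ (k * d) * G l = G l * (X ^ (l ^ 2 * (k * d)) * Z d) := by
    rw [← hZl, ← hii, ← Matrix.mul_assoc, ← Matrix.mul_assoc, Matrix.mul_nonsing_inv _ hGdet,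
      Matrix.one_mul]
  have hkey : X ^ (k * d) * G l * T ^ (-(α * l * d)) = G l * Z d * X ^ (l * d) := by
    rw [hmove, hTX, mul_neg, Matrix.mul_assoc, Matrix.mul_assoc, hcomm.eq, ← Matrix.mul_assoc
      (X ^ _), ← Matrix.zpow_add hXdet, Matrix.mul_assoc, hcommd.eq]
    congr 3
    linear_combination l * d * hk
  rw [hfactor a d b hdet, hfactor (l * a) (k * d) (b + α * a * d)
    (by linear_combination a * d * hk + hdet), Matrix.map_mul, Matrix.map_mul, hXmap, hXmap,
    hi σ hσ]
  simp only [Matrix.mul_assoc] at hkey ⊢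
  rw [hkey]
end

section
/- For every m = [[a,b],[c,d]] ∈ SL(2,ℤ) with c ≥ 1 and d coprime to n, one has σ_d(ρ(m)) = T^b·S^{−1}·T^{−c}·σ_d(S). -/
open Matrix Complex

theorem tM_zpow (n : ℤ) :
    tM ^ n = ⟨!![1, n; 0, 1], by rw [Matrix.det_fin_two_of]; ring⟩ :=
  Subtype.ext (ModularGroup.coe_T_zpow n)

theorem sM_inv_mul_tM_zpow_mul_sM (n : ℤ) :
    sM⁻¹ * tM ^ (-n) * sM = ⟨!![1, 0; n, 1], by rw [Matrix.det_fin_two_of]; ring⟩ := by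
  rw [mul_assoc, tM_zpow]
  refine inv_mul_eq_iff_eq_mul.2 (Subtype.ext ?_)
  change !![1, -n; 0, 1] * !![0, -1; 1, 0] = !![0, -1; 1, 0] * !![1, 0; n, 1]
  simp

theorem stmt11
    {I : Type} [Fintype I] [DecidableEq I] [Nonempty I] (i0 : I)
    (ρ : SL2Z →* (Matrix I I ℂ)ˣ)
    (S T : Matrix I I ℂ)
    (hSdef : S = (↑(ρ sM) : Matrix I I ℂ)) (hTdef : T = (↑(ρ tM) : Matrix I I ℂ))
    (n N : ℕ) (hn : 0 < n) (hNpos : 0 < N) (hNdvd : N ∣ n)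
    (hTdiag : T.IsDiag) (hTord : orderOf T = N)
    (hSsymm : S.IsSymm) (hSunit : Sᴴ * S = 1)
    (ζ : ℂ) (hζ : ζ = Complex.exp (2 * Real.pi * Complex.I / n))
    (hSfield : ∀ p q, S p q ∈ IntermediateField.adjoin ℚ {ζ})
    (perm : ℤ → Equiv.Perm I) (ε : ℤ → I → ℂ) (G : ℤ → Matrix I I ℂ)
    (hε : ∀ l : ℤ, IsCoprime l (n : ℤ) → ∀ p, ε l p = 1 ∨ ε l p = -1)
    (hG : ∀ (l : ℤ) (p q : I), G l p q = ε l q * (if p = perm l q then 1 else 0))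
    (hGal : ∀ l : ℤ, IsCoprime l (n : ℤ) → ∀ σ : ℂ →+* ℂ, σ ζ = ζ ^ l →
      S.map σ = S * G l ∧ G l * S.map σ = S)
    (hGT : ∀ l : ℤ, IsCoprime l (n : ℤ) → (G l)⁻¹ * T * G l = T ^ (l ^ 2 : ℤ))
    (hFormula : ∀ (a b cc d l k α : ℤ) (hcc : 1 ≤ cc) (hdet : a * d - b * cc = 1)
      (hl : IsCoprime l ((n : ℤ) * cc)) (hk : l * k = 1 + α * cc),
      ∀ σ : ℂ →+* ℂ, σ ζ = ζ ^ l →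
        ((↑(ρ ⟨!![a, b; cc, d], by rw [Matrix.det_fin_two_of]; linarith⟩) :
            Matrix I I ℂ)).map σ =
          (↑(ρ ⟨!![l * a, b + α * a * d; cc, k * d],
              by rw [Matrix.det_fin_two_of]; linear_combination a * d * hk + hdet⟩) :
            Matrix I I ℂ) * G l * T ^ (-(α * l * d))) :
    ∀ (a b cc d : ℤ) (hcc : 1 ≤ cc) (hdet : a * d - b * cc = 1), IsCoprime d (n : ℤ) →
      ∀ σ : ℂ →+* ℂ, σ ζ = ζ ^ d →
        ((↑(ρ ⟨!![a, b; cc, d], by rw [Matrix.det_fin_two_of]; linarith⟩) :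
            Matrix I I ℂ)).map σ = T ^ b * S⁻¹ * T ^ (-cc) * S.map σ := by
  intro a b cc d hcc hdet hd σ hσ
  have hdc : IsCoprime d cc := ⟨a, -b, by linear_combination hdet⟩
  rw [hFormula a b cc d d a b hcc hdet (hd.mul_right hdc) (by linear_combination hdet) σ hσ]
  have hfactor : (⟨!![d * a, b + b * a * d; cc, a * d],
      by rw [Matrix.det_fin_two_of]; linear_combination (a * d + 1) * hdet⟩ : SL2Z) =
      tM ^ b * (sM⁻¹ * tM ^ (-cc) * sM) * tM ^ b := by
    have had : a * d = 1 + b * cc := by linear_combination hdet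
    rw [sM_inv_mul_tM_zpow_mul_sM, tM_zpow]
    refine Subtype.ext ?_
    change !![d * a, b + b * a * d; cc, a * d] =
      !![1, b; 0, 1] * !![1, 0; cc, 1] * !![1, b; 0, 1]
    rw [Matrix.mul_fin_two, Matrix.mul_fin_two, mul_comm d a, mul_assoc b a d, had]
    ring_nf
  obtain ⟨hS, hGS⟩ := hGal d hd σ hσ
  have hSinv : S * S⁻¹ = 1 := Matrix.mul_nonsing_inv S
    ((Matrix.isUnit_iff_isUnit_det S).1 (hSdef ▸ (ρ sM).isUnit))
  have hGdet : IsUnit (G d).det := by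
    refine Matrix.isUnit_det_of_right_inverse (B := S.map σ * S⁻¹) ?_
    rw [← Matrix.mul_assoc, hGS, hSinv]
  have hTdet : IsUnit T.det :=
    (Matrix.isUnit_iff_isUnit_det T).1 (hTdef ▸ (ρ tM).isUnit)
  have hsemi : SemiconjBy (G d) (T ^ (d ^ 2)) T := by
    rw [SemiconjBy, ← hGT d hd, Matrix.mul_assoc, Matrix.mul_nonsing_inv_cancel_left _ _ hGdet]
  have hTb : T ^ b * G d = G d * T ^ (d ^ 2 * b) := by
    rw [Matrix.zpow_mul _ hTdet]
    exact (Matrix.SemiconjBy.zpow_right (hTdet.det_zpow _) hTdet hsemi b).symm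
  have hcancel : T ^ (d ^ 2 * b) * T ^ (-(b * d * d)) = 1 := by
    rw [← Matrix.zpow_add hTdet, show d ^ 2 * b + -(b * d * d) = 0 by ring, zpow_zero]
  rw [hfactor, hS]
  simp only [map_mul, map_inv, map_zpow, Units.val_mul, Matrix.coe_units_zpow,
    Matrix.coe_units_inv, ← hSdef, ← hTdef]
  calc T ^ b * (S⁻¹ * T ^ (-cc) * S) * T ^ b * G d * T ^ (-(b * d * d))
      = T ^ b * (S⁻¹ * T ^ (-cc) * S) * (T ^ b * G d) * T ^ (-(b * d * d)) := by
        simp only [Matrix.mul_assoc]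
    _ = T ^ b * (S⁻¹ * T ^ (-cc) * S) * G d * (T ^ (d ^ 2 * b) * T ^ (-(b * d * d))) := by
        rw [hTb]; simp only [Matrix.mul_assoc]
    _ = T ^ b * S⁻¹ * T ^ (-cc) * (S * G d) := by
        rw [hcancel]; simp only [Matrix.mul_assoc, Matrix.mul_one]
end

section
/- Let Γ₁(N) = { [[a,b],[c,d]] ∈ SL(2,ℤ) : a ≡ d ≡ 1 (mod N), c ≡ 0 (mod N) } and Γ(N) = { [[a,b],[c,d]] ∈ Γ₁(N) : b ≡ 0 (mod N) }. Then ker ρ ∩ Γ₁(N) = Γ(N). In particular Γ(N) ⊆ ker ρ, i.e. the kernel of the modular representation ρ is a congruence subgroup of level N. -/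
open Matrix Complex

/-- An injective ring homomorphism into an algebraically closed field extends along algebraic
extensions. -/
theorem exists_ringHom_comp_algebraMap_eq {R S L : Type*} [CommRing R] [CommRing S] [IsDomain S]
    [Algebra R S] [Module.IsTorsionFree R S] [Algebra.IsAlgebraic R S] [Field L] [IsAlgClosed L]
    (g : R →+* L) (hg : Function.Injective g) :
    ∃ f : S →+* L, f.comp (algebraMap R S) = g := by
  let := g.toAlgebra
  have : FaithfulSMul R L := (faithfulSMul_iff_algebraMap_injective R L).2 hg
  have : IsDomain R := hg.isDomain g
  let f : S →ₐ[R] L := IsAlgClosed.lift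
  exact ⟨f.toRingHom, f.comp_algebraMap⟩

/-- An endomorphism of a subfield of an algebraically closed field extends to the whole field. -/
theorem exists_ringHom_extending_endomorphism {K L : Type*} [Field K] [Field L] [IsAlgClosed L]
    [Algebra K L] (φ : K →+* K) :
    ∃ f : L →+* L, ∀ x, f (algebraMap K L x) = algebraMap K L (φ x) := by
  obtain ⟨s, hs⟩ := exists_isTranscendenceBasis K L
  have hind := hs.1
  have := hs.isAlgebraic
  let g : Algebra.adjoin K (Set.range ((↑) : s → L)) →+* L :=
    ((MvPolynomial.aeval ((↑) : s → L)).toRingHom.comp (MvPolynomial.map φ)).comp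
      hind.aevalEquiv.symm.toAlgHom.toRingHom
  have hg : Function.Injective g :=
    (Function.Injective.comp hind (MvPolynomial.map_injective φ φ.injective)).comp
      hind.aevalEquiv.symm.injective
  obtain ⟨f, hf⟩ := exists_ringHom_comp_algebraMap_eq (S := L) g hg
  refine ⟨f, fun x => ?_⟩
  have h := RingHom.congr_fun hf (algebraMap K _ x)
  have h' : g (algebraMap K _ x) = algebraMap K L (φ x) := by
    simp [g, MvPolynomial.algebraMap_eq]
  exact h.trans h'

/-- Every power map with exponent coprime to `n` on the `n`-th roots of unity is induced by an
endomorphism of `ℂ`. -/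
theorem exists_ringHom_apply_eq_zpow {n : ℕ} (hn : 0 < n) {ζ : ℂ} (hζ : IsPrimitiveRoot ζ n)
    {d : ℤ} (hd : IsCoprime d (n : ℤ)) : ∃ σ : ℂ →+* ℂ, σ ζ = ζ ^ d := by
  have : NeZero n := ⟨hn.ne'⟩
  let K := IntermediateField.adjoin ℚ {ζ}
  let z : K := ⟨ζ, IntermediateField.mem_adjoin_simple_self ℚ ζ⟩
  have hz : IsPrimitiveRoot z n := by
    apply IsPrimitiveRoot.of_map_of_injective (f := algebraMap K ℂ) _ (algebraMap K ℂ).injective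
    exact hζ
  have : IsCyclotomicExtension {n} ℚ K :=
    (IntermediateField.isCyclotomicExtension_singleton_iff_eq_adjoin _ _ _ _ hζ).2 rfl
  have hzd : IsPrimitiveRoot (z ^ d) n :=
    hz.zpow_of_gcd_eq_one d (Int.isCoprime_iff_gcd_eq_one.1 hd)
  let φ : K →ₐ[ℚ] K := (hz.embeddingsEquivPrimitiveRoots K
    (Polynomial.cyclotomic.irreducible_rat hn)).symm ⟨z ^ d, (mem_primitiveRoots hn).2 hzd⟩
  have hφ : φ z = z ^ d := by
    rw [← hz.embeddingsEquivPrimitiveRoots_apply_coe K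
      (Polynomial.cyclotomic.irreducible_rat hn) φ, Equiv.apply_symm_apply]
  obtain ⟨σ, hσ⟩ := exists_ringHom_extending_endomorphism (L := ℂ) φ.toRingHom
  refine ⟨σ, (hσ z).trans ?_⟩
  change algebraMap K ℂ (φ z) = _
  rw [hφ, map_zpow₀]
  rfl

theorem exists_isCoprime_add_mul {d x : ℤ} (h : IsCoprime d x) {n : ℕ} (hn : n ≠ 0) :
    ∃ j : ℤ, IsCoprime (d + j * x) (n : ℤ) := by
  classical
  let P : Finset ℕ := n.primeFactors.filter fun p : ℕ => ¬ (p : ℤ) ∣ d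
  refine ⟨((∏ p ∈ P, p : ℕ) : ℤ), ?_⟩
  rw [Int.isCoprime_iff_gcd_eq_one]
  by_contra hne
  obtain ⟨p, hp, hpg⟩ := Nat.exists_prime_and_dvd hne
  have hpz : Prime (p : ℤ) := Nat.prime_iff_prime_int.1 hp
  have hp1 : (p : ℤ) ∣ d + ((∏ p ∈ P, p : ℕ) : ℤ) * x :=
    (Int.natCast_dvd_natCast.2 hpg).trans (Int.gcd_dvd_left _ _)
  have hp2 : p ∣ n :=
    Int.natCast_dvd_natCast.1 ((Int.natCast_dvd_natCast.2 hpg).trans (Int.gcd_dvd_right _ _))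
  by_cases hpd : (p : ℤ) ∣ d
  · rcases hpz.dvd_or_dvd ((dvd_add_right hpd).1 hp1) with h1 | h1
    · obtain ⟨q, hq, hpq⟩ := (hp.prime.dvd_finsetProd_iff _).1 (Int.natCast_dvd_natCast.1 h1)
      obtain ⟨hq1, hq2⟩ := Finset.mem_filter.1 hq
      rw [(Nat.prime_dvd_prime_iff_eq hp (Nat.prime_of_mem_primeFactors hq1)).1 hpq] at hpd
      exact hq2 hpd
    · exact hpz.not_isUnit (h.isUnit_of_dvd' hpd h1)
  · have hpP : p ∈ P := Finset.mem_filter.2 ⟨Nat.mem_primeFactors.2 ⟨hp, hp2, hn⟩, hpd⟩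
    have h1 : (p : ℤ) ∣ ((∏ p ∈ P, p : ℕ) : ℤ) :=
      Int.natCast_dvd_natCast.2 (Finset.dvd_prod_of_mem _ hpP)
    exact hpd ((dvd_add_left (h1.mul_right x)).1 hp1)

/-- A homomorphism out of `SL(2, ℤ)` into invertible matrices whose values at the two generators
are fixed by `σ` takes all its values in matrices fixed by `σ`. -/
theorem map_eq_of_map_generators_eq {I : Type*} [Fintype I] [DecidableEq I]
    (ρ : SL2Z →* (Matrix I I ℂ)ˣ) (σ : ℂ →+* ℂ)
    (hS : (ρ sM : Matrix I I ℂ).map σ = ρ sM) (hT : (ρ tM : Matrix I I ℂ).map σ = ρ tM)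
    (m : SL2Z) : (ρ m : Matrix I I ℂ).map σ = ρ m := by
  have h : (Units.map (σ.mapMatrix (m := I)).toMonoidHom).comp ρ = ρ := by
    refine MonoidHom.eq_of_eqOn_dense SpecialLinearGroup.SL2Z_generators ?_
    rintro x (rfl | rfl)
    · exact Units.ext hS
    · exact Units.ext hT
  exact congrArg Units.val (DFunLike.congr_fun h m)

theorem tM_zpow_s13 (k : ℤ) : (tM ^ k : SL2Z).1 = !![1, k; 0, 1] :=
  ModularGroup.coe_T_zpow k

/-- On `Γ₁(N)` with lower right entry coprime to `n`, the Galois formula reads `ρ m = T ^ b`. -/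
theorem eq_zpow_of_galois_formula {I : Type*} [Fintype I] [DecidableEq I]
    (ρ : SL2Z →* (Matrix I I ℂ)ˣ) {n N : ℕ} (hn : 0 < n) (hNpos : 0 < N) (hNdvd : N ∣ n)
    {ζ ζN : ℂ} (hζ : IsPrimitiveRoot ζ n) (hζN : IsPrimitiveRoot ζN N)
    (hTdiag : (ρ tM : Matrix I I ℂ).IsDiag) (hTN : ρ tM ^ N = 1)
    (hSN : ∀ p q, (ρ sM : Matrix I I ℂ) p q ∈ IntermediateField.adjoin ℚ {ζN})
    {b c d : ℤ} (m : SL2Z) (hd : IsCoprime d (n : ℤ)) (hdN : (N : ℤ) ∣ d - 1)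
    (hcN : (N : ℤ) ∣ c)
    (hFor : ∀ σ : ℂ →+* ℂ, σ ζ = ζ ^ d → (ρ m : Matrix I I ℂ).map σ =
      (ρ tM : Matrix I I ℂ) ^ b * (ρ sM : Matrix I I ℂ)⁻¹ * (ρ tM : Matrix I I ℂ) ^ (-c) *
        (ρ sM : Matrix I I ℂ).map σ) :
    ρ m = ρ tM ^ b := by
  have : NeZero n := ⟨hn.ne'⟩
  have : NeZero N := ⟨hNpos.ne'⟩
  obtain ⟨σ, hσ⟩ := exists_ringHom_apply_eq_zpow hn hζ hd
  have hσN : σ ζN = ζN := by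
    obtain ⟨i, -, rfl⟩ := hζ.eq_pow_of_pow_eq_one
      (show ζN ^ n = 1 from (hζN.pow_eq_one_iff_dvd n).2 hNdvd)
    have h1 : (ζ ^ i) ^ (d - 1) = 1 := (hζN.zpow_eq_one_iff_dvd _).2 hdN
    have h0 : ζ ^ i ≠ 0 := pow_ne_zero _ (hζ.ne_zero hn.ne')
    calc σ (ζ ^ i) = (ζ ^ i) ^ d := by
          rw [map_pow, hσ, ← zpow_natCast, ← zpow_natCast, zpow_comm ζ d i]
      _ = (ζ ^ i) ^ (d - 1) * ζ ^ i := by rw [zpow_sub_one₀ h0, inv_mul_cancel_right₀ h0]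
      _ = ζ ^ i := by rw [h1, one_mul]
  have hS : (ρ sM : Matrix I I ℂ).map σ = ρ sM := by
    ext p q
    refine IntermediateField.adjoin_induction ℚ (p := fun x _ => σ x = x) ?_ ?_ ?_ ?_ ?_ (hSN p q)
    · rintro x rfl
      exact hσN
    · intro x
      simp
    · intro x y _ _ hx hy
      rw [map_add, hx, hy]
    · intro x _ hx
      rw [map_inv₀, hx]
    · intro x y _ _ hx hy
      rw [map_mul, hx, hy]
  have hT : (ρ tM : Matrix I I ℂ).map σ = ρ tM := by
    have hpow : (ρ tM : Matrix I I ℂ) ^ N = 1 := congrArg Units.val hTN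
    ext p q
    by_cases hpq : p = q
    · subst hpq
      rw [← hTdiag.diagonal_diag, diagonal_pow] at hpow
      have hpp : (ρ tM : Matrix I I ℂ) p p ^ N = 1 := by
        simpa using congrFun (congrFun hpow p) p
      obtain ⟨i, -, hi⟩ := hζN.eq_pow_of_pow_eq_one hpp
      rw [map_apply, ← hi, map_pow, hσN]
    · rw [map_apply, hTdiag hpq, map_zero]
  have hTc : ρ tM ^ (-c) = 1 := by
    obtain ⟨k, rfl⟩ := hcN
    rw [← mul_neg, _root_.zpow_mul, zpow_natCast, hTN, _root_.one_zpow]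
  have h := hFor σ hσ
  rw [map_eq_of_map_generators_eq ρ σ hS hT m, hS] at h
  apply Units.ext
  rw [h, ← coe_units_zpow, ← coe_units_zpow, ← coe_units_inv, hTc, Units.val_one, mul_one,
    mul_assoc, Units.inv_mul, mul_one]

theorem stmt13
    {I : Type} [Fintype I] [DecidableEq I] [Nonempty I] (i0 : I)
    (ρ : SL2Z →* (Matrix I I ℂ)ˣ)
    (S T : Matrix I I ℂ)
    (hSdef : S = (↑(ρ sM) : Matrix I I ℂ)) (hTdef : T = (↑(ρ tM) : Matrix I I ℂ))
    (n N : ℕ) (hn : 0 < n) (hNpos : 0 < N) (hNdvd : N ∣ n)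
    (hTdiag : T.IsDiag) (hTord : orderOf T = N)
    (hSsymm : S.IsSymm) (hSunit : Sᴴ * S = 1)
    (ζ : ℂ) (hζ : ζ = Complex.exp (2 * Real.pi * Complex.I / n))
    (hSfield : ∀ p q, S p q ∈ IntermediateField.adjoin ℚ {ζ})
    (perm : ℤ → Equiv.Perm I) (ε : ℤ → I → ℂ) (G : ℤ → Matrix I I ℂ)
    (hε : ∀ l : ℤ, IsCoprime l (n : ℤ) → ∀ p, ε l p = 1 ∨ ε l p = -1)
    (hG : ∀ (l : ℤ) (p q : I), G l p q = ε l q * (if p = perm l q then 1 else 0))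
    (hGal : ∀ l : ℤ, IsCoprime l (n : ℤ) → ∀ σ : ℂ →+* ℂ, σ ζ = ζ ^ l →
      S.map σ = S * G l ∧ G l * S.map σ = S)
    (hFor : ∀ (a b cc d : ℤ) (hdet : a * d - b * cc = 1), IsCoprime d (n : ℤ) →
      ∀ σ : ℂ →+* ℂ, σ ζ = ζ ^ d →
        ((↑(ρ ⟨!![a, b; cc, d], by rw [Matrix.det_fin_two_of]; linarith⟩) : Matrix I I ℂ)).map σ =
          T ^ b * S⁻¹ * T ^ (-cc) * S.map σ)
    (ζN : ℂ) (hζN : ζN = Complex.exp (2 * Real.pi * Complex.I / N))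
    (hSN : ∀ p q, S p q ∈ IntermediateField.adjoin ℚ {ζN})
    :
    MonoidHom.ker ρ ⊓ CongruenceSubgroup.Gamma1 N = CongruenceSubgroup.Gamma N ∧
    CongruenceSubgroup.Gamma N ≤ MonoidHom.ker ρ := by
  subst hSdef hTdef
  have hζ' : IsPrimitiveRoot ζ n := hζ ▸ Complex.isPrimitiveRoot_exp n hn.ne'
  have hζN' : IsPrimitiveRoot ζN N := hζN ▸ Complex.isPrimitiveRoot_exp N hNpos.ne'
  have hord : orderOf (ρ tM) = N := by rw [← orderOf_units, hTord]
  have hTN : ρ tM ^ N = 1 := hord ▸ pow_orderOf_eq_one (ρ tM)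
  have key : ∀ m : SL2Z, m ∈ CongruenceSubgroup.Gamma1 N → ρ m = ρ tM ^ (m.1 0 1) := by
    intro m hm
    obtain ⟨-, hd, hc⟩ := (CongruenceSubgroup.Gamma1_mem N m).1 hm
    have hdN : (N : ℤ) ∣ m.1 1 1 - 1 := by
      rw [← ZMod.intCast_zmod_eq_zero_iff_dvd, Int.cast_sub, Int.cast_one, sub_eq_zero]
      exact hd
    have hcN : (N : ℤ) ∣ m.1 1 0 := (ZMod.intCast_zmod_eq_zero_iff_dvd _ N).1 hc
    have hdet : m.1 0 0 * m.1 1 1 - m.1 0 1 * m.1 1 0 = 1 := by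
      rw [← det_fin_two, m.2]
    have hcop : IsCoprime (m.1 1 1) (N * m.1 1 0) := by
      obtain ⟨k, hk⟩ := hdN
      exact IsCoprime.mul_right ⟨1, -k, by linear_combination hk⟩
        ⟨m.1 0 0, -m.1 0 1, by linear_combination hdet⟩
    obtain ⟨j, hj⟩ := exists_isCoprime_add_mul hcop hn.ne'
    have hdet' : m.1 0 0 * (m.1 1 1 + j * (N * m.1 1 0)) -
        (m.1 0 1 + j * N * m.1 0 0) * m.1 1 0 = 1 := by linear_combination hdet
    have hρ := hFor _ _ _ _ hdet' hj
    have hmul : (⟨!![m.1 0 0, m.1 0 1 + j * N * m.1 0 0; m.1 1 0, m.1 1 1 + j * (N * m.1 1 0)],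
        by rw [Matrix.det_fin_two_of]; linarith⟩ : SL2Z) = m * tM ^ (j * N) := by
      apply Subtype.ext
      change _ = m.1 * (tM ^ (j * N) : SL2Z).1
      rw [tM_zpow_s13]
      ext p q
      fin_cases p <;> fin_cases q <;> simp [Matrix.mul_apply, Fin.sum_univ_two] <;> ring
    rw [hmul] at hρ
    have hperiod : ∀ k : ℤ, ρ tM ^ (k * N) = 1 := by
      intro k
      rw [mul_comm, _root_.zpow_mul, zpow_natCast, hTN, _root_.one_zpow]
    have h := eq_zpow_of_galois_formula ρ hn hNpos hNdvd hζ' hζN' hTdiag hTN hSN _ hj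
      (by
        rw [add_sub_right_comm]
        exact hdN.add ((Dvd.intro _ rfl : (N : ℤ) ∣ N * m.1 1 0).mul_left j)) hcN hρ
    rw [map_mul, map_zpow, hperiod, mul_one, _root_.zpow_add, mul_right_comm j, hperiod, mul_one] at h
    exact h
  have hmem : ∀ m : SL2Z, m ∈ CongruenceSubgroup.Gamma N ↔
      m ∈ CongruenceSubgroup.Gamma1 N ∧ ((m.1 0 1 : ℤ) : ZMod N) = 0 := by
    intro m
    rw [CongruenceSubgroup.Gamma_mem, CongruenceSubgroup.Gamma1_mem]
    tauto
  have heq : MonoidHom.ker ρ ⊓ CongruenceSubgroup.Gamma1 N = CongruenceSubgroup.Gamma N := by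
    ext m
    rw [Subgroup.mem_inf, hmem, and_comm]
    refine and_congr_right fun hm => ?_
    rw [MonoidHom.mem_ker, key m hm, ← orderOf_dvd_iff_zpow_eq_one, hord,
      ZMod.intCast_zmod_eq_zero_iff_dvd]
  exact ⟨heq, heq ▸ inf_le_left⟩
end

section
/- Let k be an integer coprime to c, and let m = [[k,y],[c,x]] and m' = [[k,y'],[c,x']] be two elements of SL(2,ℤ) with the same first column (k,c). Then X^{−k}·ρ(m)·X^{−x} = X^{−k}·ρ(m')·X^{−x'}. Hence the matrix Λ(k/c) := X^{−k}·ρ(m)·X^{−x} is well defined, independent of the choice of m. -/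
open Matrix Complex

theorem tM_eq_modularGroup_T : tM = ModularGroup.T := rfl

/-- Two elements of `SL(2, ℤ)` with the same first column differ by a power of `tM`. -/
theorem exists_eq_mul_tM_zpow_of_col_eq {m m' : SL2Z} (h0 : m' 0 0 = m 0 0)
    (h1 : m' 1 0 = m 1 0) :
    ∃ j : ℤ, m' = m * tM ^ j ∧ m' 1 1 = m 1 0 * j + m 1 1 := by
  have hd := Matrix.SpecialLinearGroup.det_coe m
  have hd' := Matrix.SpecialLinearGroup.det_coe m'
  rw [Matrix.det_fin_two] at hd hd'
  rw [h0, h1] at hd'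
  refine ⟨m 1 1 * m' 0 1 - m 0 1 * m' 1 1, ?_, by linear_combination m 1 1 * hd' - m' 1 1 * hd⟩
  ext i j
  rw [tM_eq_modularGroup_T, Matrix.SpecialLinearGroup.coe_mul, ModularGroup.coe_T_zpow]
  fin_cases i <;> fin_cases j <;> simp [Matrix.mul_apply, Fin.sum_univ_two, h0, h1]
  · linear_combination m 0 1 * hd' - m' 0 1 * hd
  · linear_combination m 1 1 * hd' - m' 1 1 * hd

theorem stmt16
    {I : Type} [Fintype I] [DecidableEq I] [Nonempty I] (i0 : I)
    (ρ : SL2Z →* (Matrix I I ℂ)ˣ)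
    (S T : Matrix I I ℂ)
    (hSdef : S = (↑(ρ sM) : Matrix I I ℂ)) (hTdef : T = (↑(ρ tM) : Matrix I I ℂ))
    (n N : ℕ) (hn : 0 < n) (hNpos : 0 < N) (hNdvd : N ∣ n)
    (hTdiag : T.IsDiag) (hTord : orderOf T = N)
    (hSsymm : S.IsSymm) (hSunit : Sᴴ * S = 1)
    (ζ : ℂ) (hζ : ζ = Complex.exp (2 * Real.pi * Complex.I / n))
    (hSfield : ∀ p q, S p q ∈ IntermediateField.adjoin ℚ {ζ})
    (c : ℕ) (hc : 0 < c)
    (X : Matrix I I ℂ) (hXdiag : X.IsDiag) (hXpow : X ^ (c : ℕ) = T) :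
    ∀ k : ℤ, IsCoprime k (c : ℤ) → ∀ m m' : SL2Z,
      m 0 0 = k → m 1 0 = (c : ℤ) → m' 0 0 = k → m' 1 0 = (c : ℤ) →
      X ^ (-k) * (↑(ρ m) : Matrix I I ℂ) * X ^ (-(m 1 1)) =
        X ^ (-k) * (↑(ρ m') : Matrix I I ℂ) * X ^ (-(m' 1 1)) := by
  intro k _ m m' hm0 hm1 hm0' hm1'
  obtain ⟨j, rfl, hx⟩ :=
    exists_eq_mul_tM_zpow_of_col_eq (hm0'.trans hm0.symm) (hm1'.trans hm1.symm)
  obtain ⟨u, rfl⟩ : IsUnit X :=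
    (isUnit_pow_iff hc.ne').1 (by rw [hXpow, hTdef]; exact (ρ tM).isUnit)
  have hu : ρ tM = u ^ c := Units.ext (by rw [Units.val_pow_eq_pow_val, hXpow, hTdef])
  have key : (u ^ c) ^ j * u ^ (-((c : ℤ) * j + m 1 1)) = u ^ (-(m 1 1)) := by
    rw [← zpow_natCast u c, ← _root_.zpow_mul, ← _root_.zpow_add]
    congr 1
    ring
  rw [hx, hm1, map_mul, map_zpow, hu, ← Matrix.coe_units_zpow, ← Matrix.coe_units_zpow,
    ← Matrix.coe_units_zpow, ← key]
  simp only [Units.val_mul, mul_assoc]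
end
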